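/- arXiv:2301.09331 — 6 statements merged into one kernel-verified Lean document; each statement's English description precedes it below -/
import Mathlib

section
/- Let ℓ ≥ 2 and p ≥ 2 be integers. Let J̃ = ℤ[d_q^{±1}, d^{±1}] be the Laurent polynomial ring in two commuting variables d_q, d over ℤ, and let J̃[X_{-1}, X_0, X_1, …] be the polynomial ring over J̃ in countably many variables. Let I be the ideal generated by the element E_{ℓ-1}(X_{-1}; d_q)·(X_0 − D_ℓ(X_{-1}; d_q)) together with the elements E_{p-1}(X_i; d)·(X_{i+1} − D_p(X_i; d)) for every i ≥ 0. Then the quotient ring J̃[X_{-1}, X_0, X_1, …]/I is a reduced ring. (This is Theorem 4.3 of the paper — the ring A of twisted tilting modules of quantum GL_2 is reduced — expressed through the presentation of A given by Proposition 4.2.) -/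
noncomputable section

/-- `J̃ = ℤ[d_q^{±1}, d^{±1}]`, the Laurent polynomial ring in two commuting variables
over `ℤ`, realized as the group algebra `ℤ[ℤ × ℤ]`. -/
abbrev Jtilde : Type := AddMonoidAlgebra ℤ (ℤ × ℤ)

/-- The variable `d_q` of `J̃`. -/
noncomputable def dq : Jtilde := AddMonoidAlgebra.single (1, 0) 1

/-- The variable `d` of `J̃`. -/
noncomputable def dd : Jtilde := AddMonoidAlgebra.single (0, 1) 1

section DicksonPolynomials

open Polynomial

theorem Polynomial.dickson_succ_monic_natDegree_degree_le {R : Type*} [CommRing R] [Nontrivial R]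
    (k : ℕ) (a : R) (n : ℕ) :
    (dickson k a (n + 1)).Monic ∧ (dickson k a (n + 1)).natDegree = n + 1 ∧
      (dickson k a n).degree ≤ n := by
  induction n with
  | zero =>
    refine ⟨by simp, by simp, ?_⟩
    have h : dickson k a 0 = C (3 - k : R) := by simp [map_ofNat C]
    rw [h]
    exact degree_C_le
  | succ n ih =>
    obtain ⟨hmonic, hdeg, hle⟩ := ih
    have hX : (X * dickson k a (n + 1)).Monic := monic_X.mul hmonic
    have hXdeg : (X * dickson k a (n + 1)).natDegree = n + 2 := by
      rw [monic_X.natDegree_mul hmonic, natDegree_X, hdeg, add_comm]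
    have hlt : (C a * dickson k a n).degree < (X * dickson k a (n + 1)).degree := by
      rw [degree_eq_natDegree hX.ne_zero, hXdeg]
      refine ((degree_mul_le _ _).trans (add_le_add degree_C_le hle)).trans_lt ?_
      rw [zero_add]
      exact_mod_cast Nat.lt_add_of_pos_right two_pos
    refine ⟨?_, ?_, ?_⟩
    · rw [dickson_add_two]
      exact hX.sub_of_left hlt
    · rw [dickson_add_two, natDegree_eq_of_degree_eq (degree_sub_eq_left_of_degree_lt hlt), hXdeg]
    · rw [degree_eq_natDegree hmonic.ne_zero, hdeg]

theorem Polynomial.dickson_monic {R : Type*} [CommRing R] [Nontrivial R] (k : ℕ) (a : R) {n : ℕ}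
    (hn : n ≠ 0) : (dickson k a n).Monic := by
  obtain ⟨n, rfl⟩ := Nat.exists_eq_succ_of_ne_zero hn
  exact (dickson_succ_monic_natDegree_degree_le k a n).1

theorem Polynomial.natDegree_dickson {R : Type*} [CommRing R] [Nontrivial R] (k : ℕ) (a : R)
    {n : ℕ} (hn : n ≠ 0) : (dickson k a n).natDegree = n := by
  obtain ⟨n, rfl⟩ := Nat.exists_eq_succ_of_ne_zero hn
  exact (dickson_succ_monic_natDegree_degree_le k a n).2.1

theorem Polynomial.dickson_one_add_X_mul_dickson_two {R : Type*} [CommRing R] (a : R) (n : ℕ) :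
    dickson 1 a (n + 1) + X * dickson 2 a n = 2 * dickson 2 a (n + 1) := by
  induction n using Nat.twoStepInduction with
  | zero => simp; ring
  | one => simp; ring
  | more n h₀ h₁ =>
    rw [dickson_add_two 1 a (n + 1), dickson_add_two 2 a (n + 1)]
    rw [dickson_add_two 2 a n] at h₁ ⊢
    linear_combination X * h₁ - C a * h₀

theorem Polynomial.X_mul_dickson_one_add_discr_mul_dickson_two {R : Type*} [CommRing R] (a : R)
    (n : ℕ) :
    X * dickson 1 a (n + 1) + (X ^ 2 - 4 * C a) * dickson 2 a n = 2 * dickson 1 a (n + 2) := by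
  induction n using Nat.twoStepInduction with
  | zero => simp; ring
  | one => simp; ring
  | more n h₀ h₁ =>
    rw [dickson_add_two 1 a (n + 1 + 1), dickson_add_two 1 a (n + 1), dickson_add_two 2 a n]
    rw [dickson_add_two 1 a (n + 1)] at h₁
    linear_combination X * h₁ - C a * h₀

theorem Polynomial.dickson_one_sq_sub {K : Type*} [Field K] [CharZero K] (a : K) (n : ℕ) :
    dickson 1 a (n + 1) ^ 2 - (X ^ 2 - 4 * C a) * dickson 2 a n ^ 2 = 4 * C a ^ (n + 1) := by
  induction n with
  | zero => simp; ring
  | succ n ih =>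
    have h₁ := dickson_one_add_X_mul_dickson_two a n
    have h₂ := X_mul_dickson_one_add_discr_mul_dickson_two a n
    refine mul_left_cancel₀ (by norm_num : (4 : K[X]) ≠ 0) ?_
    linear_combination
      4 * C a * ih - (X * dickson 1 a (n + 1) + (X ^ 2 - 4 * C a) * dickson 2 a n +
        2 * dickson 1 a (n + 2)) * h₂ + (X ^ 2 - 4 * C a) *
        (dickson 1 a (n + 1) + X * dickson 2 a n + 2 * dickson 2 a (n + 1)) * h₁

theorem Polynomial.derivative_dickson_one {R : Type*} [CommRing R] (a : R) (n : ℕ) :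
    derivative (dickson 1 a (n + 1)) = (n + 1 : R[X]) * dickson 2 a n := by
  induction n using Nat.twoStepInduction with
  | zero => simp; ring
  | one => simp; ring
  | more n h₀ h₁ =>
    have h := dickson_one_add_X_mul_dickson_two a (n + 1)
    rw [dickson_add_two 1 a (n + 1), derivative_sub, derivative_mul, derivative_X,
      derivative_C_mul, h₀, h₁]
    rw [dickson_add_two 2 a n] at h ⊢
    push_cast
    linear_combination h

theorem Polynomial.discr_mul_derivative_dickson_two {K : Type*} [Field K] [CharZero K] (a : K)
    (n : ℕ) :
    X * dickson 2 a n + (X ^ 2 - 4 * C a) * derivative (dickson 2 a n) =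
      (n + 1 : K[X]) * dickson 1 a (n + 1) := by
  have hne : dickson 2 a n ≠ 0 := by
    cases n with
    | zero => simp; norm_num
    | succ n => exact (dickson_monic 2 a n.succ_ne_zero).ne_zero
  have h := congrArg derivative (dickson_one_sq_sub a n)
  have hconst : derivative (4 * C a ^ (n + 1) : K[X]) = 0 := by
    rw [← C_pow, ← map_ofNat C 4, ← C_mul, derivative_C]
  have hdiscr : derivative (X ^ 2 - 4 * C a : K[X]) = 2 * X := by
    rw [← map_ofNat C 4, ← C_mul, derivative_sub, derivative_C, derivative_X_sq, map_ofNat, sub_zero]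
  rw [hconst, derivative_sub, derivative_mul, hdiscr, sq, sq (dickson 2 a n), derivative_mul,
    derivative_mul, derivative_dickson_one] at h
  refine mul_left_cancel₀ (mul_ne_zero two_ne_zero hne) ?_
  linear_combination -h

theorem Polynomial.separable_dickson_two_mul_sub_dickson_one {K : Type*} [Field K] [CharZero K]
    [IsAlgClosed K] {a y : K} (ha : a ≠ 0) {n : ℕ} (hy : y ^ 2 ≠ 4 * a ^ (n + 1)) :
    (dickson 2 a n * (C y - dickson 1 a (n + 1))).Separable := by
  have hsq (z : K) := congrArg (eval z) (dickson_one_sq_sub a n)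
  have hder (z : K) := congrArg (eval z) (discr_mul_derivative_dickson_two a n)
  simp only [eval_sub, eval_mul, eval_pow, eval_X, eval_C, eval_ofNat] at hsq
  simp only [eval_add, eval_sub, eval_mul, eval_pow, eval_X, eval_C, eval_ofNat, eval_natCast,
    eval_one] at hder
  have hn : (n + 1 : K) ≠ 0 := Nat.cast_add_one_ne_zero n
  have hnot (z : K) (hE : eval z (dickson 2 a n) = 0) (hD : y = eval z (dickson 1 a (n + 1))) :
      False := hy <| by
    rw [hD, ← hsq z, hE]
    ring
  refine Separable.mul ?_ ?_ ?_
  · refine (isCoprime_iff_aeval_ne_zero_of_isAlgClosed K K _ _).2 fun z ↦ ?_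
    simp only [coe_aeval_eq_eval]
    by_contra! h
    have h₁ := hder z
    rw [h.1, h.2, mul_zero, mul_zero, add_zero, eq_comm, mul_eq_zero, or_iff_right hn] at h₁
    have h₂ := hsq z
    rw [h.1, h₁] at h₂
    have : 4 * a ^ (n + 1) ≠ 0 := mul_ne_zero (by norm_num) (pow_ne_zero _ ha)
    exact this (by rw [← h₂]; ring)
  · refine (isCoprime_iff_aeval_ne_zero_of_isAlgClosed K K _ _).2 fun z ↦ ?_
    simp only [coe_aeval_eq_eval, derivative_sub, derivative_C, derivative_dickson_one, zero_sub,
      eval_neg, eval_mul, eval_sub, eval_C, eval_add, eval_natCast, eval_one]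
    by_contra! h
    exact hnot z (by simpa [hn] using h.2) (sub_eq_zero.1 h.1)
  · refine (isCoprime_iff_aeval_ne_zero_of_isAlgClosed K K _ _).2 fun z ↦ ?_
    simp only [coe_aeval_eq_eval, eval_sub, eval_C]
    by_contra! h
    exact hnot z h.1 (sub_eq_zero.1 h.2)

theorem norm_recurrence_growth {a y : ℂ} {s : ℝ} (hs : 0 < s) (ha : ‖a‖ = s ^ 2)
    (hy : 2 * s ≤ ‖y‖) {u : ℕ → ℂ} (hu : ∀ n, u (n + 2) = y * u (n + 1) - a * u n)
    (h₁ : s * ‖u 0‖ ≤ ‖u 1‖) (n : ℕ) : s * ‖u n‖ ≤ ‖u (n + 1)‖ := by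
  induction n with
  | zero => exact h₁
  | succ n ih =>
    have h := norm_sub_norm_le (y * u (n + 1)) (a * u n)
    rw [← hu, norm_mul, norm_mul, ha] at h
    nlinarith [mul_le_mul_of_nonneg_right hy (norm_nonneg (u (n + 1))),
      mul_le_mul_of_nonneg_left ih hs.le]

theorem norm_recurrence_lower_bound {a y : ℂ} {s : ℝ} (hs : 1 ≤ s) (ha : ‖a‖ = s ^ 2)
    (hy : 2 * s ≤ ‖y‖) {u : ℕ → ℂ} (hu : ∀ n, u (n + 2) = y * u (n + 1) - a * u n)
    (h₁ : s * ‖u 0‖ ≤ ‖u 1‖) (n : ℕ) : ‖u 1‖ ≤ ‖u (n + 1)‖ := by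
  have h := norm_recurrence_growth (one_pos.trans_le hs) ha hy hu h₁
  induction n with
  | zero => rfl
  | succ n ih =>
    exact ih.trans ((le_mul_of_one_le_left (norm_nonneg _) hs).trans (h (n + 1)))

theorem Polynomial.norm_lt_norm_eval_dickson_one {a y : ℂ} {s : ℝ} (hs : 1 ≤ s)
    (ha : ‖a‖ = s ^ 2) (hy : 2 * s < ‖y‖) (n : ℕ) :
    2 * s < ‖(dickson 1 a (n + 1)).eval y‖ := by
  have h := norm_recurrence_lower_bound (u := fun n ↦ (dickson 1 a n).eval y) hs ha hy.le
    (fun n ↦ by simp) (by norm_num; linarith) n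
  simp only [dickson_one, eval_X] at h
  exact hy.trans_le h

theorem Polynomial.eval_dickson_two_ne_zero {a y : ℂ} {s : ℝ} (hs : 1 ≤ s)
    (ha : ‖a‖ = s ^ 2) (hy : 2 * s < ‖y‖) (n : ℕ) :
    (dickson 2 a (n + 1)).eval y ≠ 0 := by
  have h := norm_recurrence_lower_bound (u := fun n ↦ (dickson 2 a n).eval y) hs ha hy.le
    (fun n ↦ by simp) (by norm_num; linarith) n
  simp only [dickson_one, eval_X] at h
  exact norm_pos_iff.1 ((by linarith : 0 < ‖y‖).trans_le h)

end DicksonPolynomials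

section Chains

open Polynomial

variable {R K : Type*} [CommRing R] [Field K]

/-- The relation `q(X_i) * (X_{i+1} - h(X_i))` attached to the `i`-th variable. -/
def chainRelation (q h : ℕ → R[X]) (i : ℕ) : MvPolynomial ℕ R :=
  aeval (MvPolynomial.X i) (q i) * (MvPolynomial.X (i + 1) - aeval (MvPolynomial.X i) (h i))

/-- The sequence `v` satisfies, after specializing the coefficients along `φ`, all the
relations with index at least `m`. -/
def IsChainFrom (q h : ℕ → R[X]) (φ : R →+* K) (m : ℕ) (v : ℕ → K) : Prop :=
  ∀ i, m ≤ i → (q i).eval₂ φ (v i) = 0 ∨ v (i + 1) = (h i).eval₂ φ (v i)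

theorem eval₂Hom_aeval_X (φ : R →+* K) (v : ℕ → K) (i : ℕ) (f : R[X]) :
    MvPolynomial.eval₂Hom φ v (aeval (MvPolynomial.X i) f) = f.eval₂ φ (v i) := by
  rw [aeval_def, hom_eval₂]
  congr 1
  · ext r
    simp [MvPolynomial.algebraMap_eq]
  · simp

theorem IsChainFrom.eval₂Hom_chainRelation {q h : ℕ → R[X]} {φ : R →+* K} {m : ℕ} {v : ℕ → K}
    (hv : IsChainFrom q h φ m v) {i : ℕ} (hi : m ≤ i) :
    MvPolynomial.eval₂Hom φ v (chainRelation q h i) = 0 := by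
  rw [chainRelation, map_mul, map_sub, eval₂Hom_aeval_X, eval₂Hom_aeval_X, mul_eq_zero, sub_eq_zero]
  simpa using hv i hi

theorem exists_isChainFrom (q h : ℕ → R[X]) (φ : R →+* K) (n : ℕ) (t : K) :
    ∃ v : ℕ → K, v n = t ∧ IsChainFrom q h φ n v := by
  let w : ℕ → K := fun j ↦ Nat.rec t (fun k x ↦ (h (n + k)).eval₂ φ x) j
  refine ⟨fun i ↦ w (i - n), by simp [w], fun i hi ↦ Or.inr ?_⟩
  obtain ⟨j, rfl⟩ := Nat.exists_eq_add_of_le hi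
  simp [w, add_assoc]

theorem IsChainFrom.update {q h : ℕ → R[X]} {φ : R →+* K} {m : ℕ} {v : ℕ → K}
    (hv : IsChainFrom q h φ (m + 1) v) {z : K}
    (hz : (q m).eval₂ φ z = 0 ∨ v (m + 1) = (h m).eval₂ φ z) :
    IsChainFrom q h φ m (Function.update v m z) := by
  intro i hi
  obtain rfl | hlt := hi.eq_or_lt
  · simpa using hz
  · simpa [Function.update_of_ne hlt.ne', Function.update_of_ne (hlt.trans i.lt_succ_self).ne']
      using hv i hlt

theorem eval₂Hom_eq_of_mem_supported {φ : R →+* K} {v w : ℕ → K} {s : Set ℕ}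
    (hvw : Set.EqOn v w s) {f : MvPolynomial ℕ R} (hf : f ∈ MvPolynomial.supported R s) :
    MvPolynomial.eval₂Hom φ v f = MvPolynomial.eval₂Hom φ w f := by
  refine MvPolynomial.eval₂Hom_congr' rfl (fun i hi _ ↦ ?_) rfl
  exact hvw (MvPolynomial.mem_supported.1 hf hi)

theorem exists_aeval_X_eq_of_mem_supported_insert {s : Set ℕ} {m : ℕ} {f : MvPolynomial ℕ R}
    (hf : f ∈ MvPolynomial.supported R (insert m s)) :
    ∃ P : (MvPolynomial.supported R s)[X], aeval (MvPolynomial.X m) P = f := by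
  rw [MvPolynomial.supported_eq_adjoin_X, Set.image_insert_eq, Set.insert_eq, Set.union_comm,
    Algebra.adjoin_union_eq_adjoin_adjoin, Subalgebra.mem_restrictScalars,
    Algebra.adjoin_singleton_eq_range_aeval] at hf
  exact hf

theorem Polynomial.Separable.eq_zero_of_degree_lt_of_eval_eq_zero [IsAlgClosed K] {f g : K[X]}
    (hf : f.Separable) (hdeg : g.degree < f.degree) (hroot : ∀ z, f.eval z = 0 → g.eval z = 0) :
    g = 0 := by
  by_contra hg
  have hle : f.roots ≤ g.roots := (Multiset.le_iff_subset (nodup_roots hf)).2 fun z hz ↦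
    (mem_roots hg).2 (hroot z (isRoot_of_mem_roots hz))
  have hcard := Multiset.card_le_card hle
  rw [← (IsAlgClosed.splits f).natDegree_eq_card_roots] at hcard
  exact (natDegree_lt_natDegree hg hdeg).not_ge (hcard.trans (card_roots' g))

theorem mem_of_forall_isChainFrom_eval_eq_zero [IsAlgClosed K] [Nontrivial R] {q h : ℕ → R[X]}
    (hq : ∀ i, (q i).Monic) (hh : ∀ i, (h i).Monic) (hh' : ∀ i, (h i).natDegree ≠ 0)
    {I : Ideal (MvPolynomial ℕ R)} (hI : ∀ i, chainRelation q h i ∈ I) {n : ℕ}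
    {T : Set ((R →+* K) × K)}
    (hT : ∀ f : R[X], (∀ φ t, (φ, t) ∈ T → f.eval₂ φ t = 0) → f = 0)
    (hsep : ∀ φ t, (φ, t) ∈ T → ∀ m < n, ∀ v : ℕ → K, v n = t → IsChainFrom q h φ (m + 1) v →
      ((q m).map φ * (C (v (m + 1)) - (h m).map φ)).Separable)
    {m : ℕ} (hm : m ≤ n) {f : MvPolynomial ℕ R}
    (hf : f ∈ MvPolynomial.supported R (Set.Icc m n))
    (hf₀ : ∀ φ t, (φ, t) ∈ T → ∀ v : ℕ → K, v n = t → IsChainFrom q h φ m v →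
      MvPolynomial.eval₂Hom φ v f = 0) : f ∈ I := by
  induction hm using Nat.decreasingInduction generalizing f with
  | self =>
    rw [Set.Icc_self, MvPolynomial.supported_eq_adjoin_X, Set.image_singleton,
      Algebra.adjoin_singleton_eq_range_aeval] at hf
    obtain ⟨g, rfl⟩ := hf
    have hg : g = 0 := hT g fun φ t ht ↦ by
      obtain ⟨v, rfl, hv⟩ := exists_isChainFrom q h φ n t
      rw [← hf₀ φ _ ht v rfl hv]
      exact (eval₂Hom_aeval_X φ v n g).symm
    simp [hg]
  | of_succ m hm ih =>
    let A := MvPolynomial.supported R (Set.Icc (m + 1) n)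
    have hIcc : Set.Icc m n = insert m (Set.Icc (m + 1) n) := by
      ext i; simp only [Set.mem_Icc, Set.mem_insert_iff]; omega
    rw [hIcc] at hf
    obtain ⟨P, rfl⟩ := exists_aeval_X_eq_of_mem_supported_insert hf
    let x : A := ⟨MvPolynomial.X (m + 1), Algebra.subset_adjoin ⟨m + 1, ⟨le_rfl, hm⟩, rfl⟩⟩
    let F : A[X] := (q m).map (algebraMap R A) * ((h m).map (algebraMap R A) - C x)
    have hFm : F.Monic := by
      refine ((hq m).map _).mul (((hh m).map _).sub_of_left ?_)
      refine degree_C_le.trans_lt ?_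
      rw [(hh m).degree_map]
      exact natDegree_pos_iff_degree_pos.1 (Nat.pos_of_ne_zero (hh' m))
    have hFaeval : aeval (MvPolynomial.X m : MvPolynomial ℕ R) F = -chainRelation q h m := by
      rw [chainRelation, map_mul, aeval_sub, aeval_map_algebraMap, aeval_map_algebraMap, aeval_C,
        show algebraMap A (MvPolynomial ℕ R) x = MvPolynomial.X (m + 1) from rfl]
      ring
    have hFI : aeval (MvPolynomial.X m : MvPolynomial ℕ R) F ∈ I := by
      rw [hFaeval]
      exact I.neg_mem (hI m)
    have hP := modByMonic_add_div P F
    have hcoeff (j : ℕ) : ((P %ₘ F).coeff j : MvPolynomial ℕ R) ∈ I := by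
      refine ih ((P %ₘ F).coeff j).2 fun φ t ht v hvt hv ↦ ?_
      let ψ : A →+* K := (MvPolynomial.eval₂Hom φ v).comp (algebraMap A (MvPolynomial ℕ R))
      have hψR : ψ.comp (algebraMap R A) = φ := by
        ext r
        exact MvPolynomial.eval₂Hom_C φ v r
      have hψx : ψ x = v (m + 1) := MvPolynomial.eval₂Hom_X' φ v (m + 1)
      have hFψ : F.map ψ = -((q m).map φ * (C (v (m + 1)) - (h m).map φ)) := by
        simp only [F, Polynomial.map_mul, Polynomial.map_sub, map_C, Polynomial.map_map, hψR, hψx]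
        ring
      have hFsep : (F.map ψ).Separable := by
        rw [hFψ, ← neg_one_mul]
        exact (hsep φ t ht m hm v hvt hv).unit_mul isUnit_one.neg
      have hr : (P %ₘ F).map ψ = 0 := by
        refine hFsep.eq_zero_of_degree_lt_of_eval_eq_zero ?_ fun z hz ↦ ?_
        · rw [hFm.degree_map]
          exact degree_map_le.trans_lt (degree_modByMonic_lt P hFm)
        have hz' := hz
        rw [hFψ, eval_neg, neg_eq_zero, eval_mul, mul_eq_zero, eval_sub, eval_C, sub_eq_zero,
          eval_map, eval_map] at hz'
        have hw := hv.update hz'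
        have heval (Q : A[X]) : MvPolynomial.eval₂Hom φ (Function.update v m z)
            (aeval (MvPolynomial.X m) Q) = (Q.map ψ).eval z := by
          rw [aeval_def, hom_eval₂, eval_map]
          congr 1
          · ext a
            refine eval₂Hom_eq_of_mem_supported (fun i hi ↦ ?_) a.2
            exact Function.update_of_ne (Nat.lt_of_succ_le hi.1).ne' _ _
          · simp
        have h₀ := hf₀ φ t ht _ (by rw [Function.update_of_ne hm.ne', hvt]) hw
        rw [heval, ← hP, Polynomial.map_add, Polynomial.map_mul, eval_add, eval_mul, hz, zero_mul,
          add_zero] at h₀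
        exact h₀
      have := congrArg (fun Q ↦ Q.coeff j) hr
      simpa [ψ] using this
    rw [← hP, map_add, map_mul]
    refine I.add_mem ?_ (I.mul_mem_right _ hFI)
    rw [aeval_eq_sum_range]
    exact I.sum_mem fun j _ ↦ I.mul_mem_right _ (hcoeff j)

theorem isReduced_quotient_chainRelation [IsAlgClosed K] [Nontrivial R] {q h : ℕ → R[X]}
    (hq : ∀ i, (q i).Monic) (hh : ∀ i, (h i).Monic) (hh' : ∀ i, (h i).natDegree ≠ 0)
    (T : ℕ → Set ((R →+* K) × K))
    (hT : ∀ n, ∀ f : R[X], (∀ φ t, (φ, t) ∈ T n → f.eval₂ φ t = 0) → f = 0)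
    (hsep : ∀ n φ t, (φ, t) ∈ T n → ∀ m < n, ∀ v : ℕ → K, v n = t → IsChainFrom q h φ (m + 1) v →
      ((q m).map φ * (C (v (m + 1)) - (h m).map φ)).Separable) :
    IsReduced (MvPolynomial ℕ R ⧸ Ideal.span (Set.range (chainRelation q h))) := by
  rw [← Ideal.isRadical_iff_quotient_reduced]
  intro f hf
  obtain ⟨k, hk⟩ := hf
  obtain ⟨n, hn⟩ := f.vars.bddAbove
  refine mem_of_forall_isChainFrom_eval_eq_zero hq hh hh'
    (fun i ↦ Ideal.subset_span (Set.mem_range_self i)) (hT n) (hsep n) n.zero_le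
    (MvPolynomial.mem_supported.2 fun i hi ↦ ⟨i.zero_le, hn hi⟩) fun φ t _ v _ hv ↦ ?_
  have hle : Ideal.span (Set.range (chainRelation q h)) ≤
      RingHom.ker (MvPolynomial.eval₂Hom φ v) := by
    rw [Ideal.span_le]
    rintro _ ⟨i, rfl⟩
    exact hv.eval₂Hom_chainRelation i.zero_le
  have h₀ : MvPolynomial.eval₂Hom φ v (f ^ k) = 0 := hle hk
  rw [map_pow] at h₀
  exact eq_zero_of_pow_eq_zero h₀

end Chains

section Specialization

open Polynomial

/-- The specialization `d_q ↦ a`, `d ↦ b` of `J̃` at nonzero complex numbers. -/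
def specialization (a b : ℂˣ) : Jtilde →+* ℂ :=
  (AddMonoidAlgebra.lift ℤ ℂ (ℤ × ℤ)
    { toFun := fun x ↦ ((a ^ x.toAdd.1 * b ^ x.toAdd.2 : ℂˣ) : ℂ)
      map_one' := by simp
      map_mul' := fun x y ↦ by
        rw [toAdd_mul, Prod.fst_add, Prod.snd_add, zpow_add, zpow_add, mul_mul_mul_comm,
          Units.val_mul] } : Jtilde →ₐ[ℤ] ℂ)

theorem specialization_dq (a b : ℂˣ) : specialization a b dq = a := by
  simp [specialization, dq]

theorem specialization_dd (a b : ℂˣ) : specialization a b dd = b := by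
  simp [specialization, dd]

theorem specialization_apply (a b : ℂˣ) (c : Jtilde) :
    specialization a b c =
      ∑ x ∈ c.coeff.support, (c.coeff x : ℂ) * ((a ^ x.1 * b ^ x.2 : ℂˣ) : ℂ) := by
  simp [specialization, AddMonoidAlgebra.lift_apply, Finsupp.sum]

theorem eq_zero_of_forall_specialization_pow_eq_zero {a b : ℂˣ}
    (hab : Function.Injective fun x : ℤ × ℤ ↦ a ^ x.1 * b ^ x.2) {c : Jtilde}
    (hc : ∀ k : ℕ, specialization (a ^ (k + 1)) (b ^ (k + 1)) c = 0) : c = 0 := by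
  let χ (x : ℤ × ℤ) : Multiplicative ℕ →* ℂ := powersHom ℂ ((a ^ x.1 * b ^ x.2 : ℂˣ) : ℂ)
  have hχ : Function.Injective χ :=
    (powersHom ℂ).injective.comp (Units.val_injective.comp hab)
  have hind := (linearIndependent_monoidHom (Multiplicative ℕ) ℂ).comp χ hχ
  have hzero := linearIndependent_iff'.1 hind c.coeff.support
    (fun x ↦ (c.coeff x : ℂ) * ((a ^ x.1 * b ^ x.2 : ℂˣ) : ℂ)) <| by
      funext k
      have h := hc k.toAdd
      rw [specialization_apply] at h
      rw [Finset.sum_apply, Pi.zero_apply, ← h]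
      refine Finset.sum_congr rfl fun x _ ↦ ?_
      have hpow : (a ^ (k.toAdd + 1)) ^ x.1 * (b ^ (k.toAdd + 1)) ^ x.2 =
          (a ^ x.1 * b ^ x.2) * (a ^ x.1 * b ^ x.2) ^ k.toAdd := by
        rw [← pow_succ', mul_pow, ← zpow_natCast, ← zpow_natCast, ← zpow_natCast, ← zpow_natCast,
          zpow_comm, zpow_comm b]
      rw [hpow]
      simp [χ, powersHom_apply, mul_assoc]
  ext x
  by_contra hx
  have := hzero x (Finsupp.mem_support_iff.2 hx)
  rw [mul_eq_zero, or_iff_left (Units.ne_zero _)] at this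
  exact hx (by exact_mod_cast this)

theorem injective_three_zpow_mul_two_zpow :
    Function.Injective fun x : ℤ × ℤ ↦ (Units.mk0 (3 : ℂ) (by norm_num)) ^ x.1 *
      (Units.mk0 (2 : ℂ) (by norm_num)) ^ x.2 := by
  intro x y hxy
  have hℚ : (3 : ℚ) ^ x.1 * 2 ^ x.2 = 3 ^ y.1 * 2 ^ y.2 := by
    have := congrArg Units.val hxy
    simp only [Units.val_mul, Units.val_zpow_eq_zpow_val, Units.val_mk0] at this
    refine Rat.cast_injective (α := ℂ) ?_
    push_cast
    exact this
  have val (r s : ℕ) [Fact r.Prime] (hrs : ¬ r ∣ s) (hs : s ≠ 0) (i j : ℤ) :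
      padicValRat r ((s : ℚ) ^ i * (r : ℚ) ^ j) = j := by
    have hr : (r : ℚ) ≠ 0 := by exact_mod_cast (Fact.out : r.Prime).ne_zero
    have hs' : (s : ℚ) ≠ 0 := by exact_mod_cast hs
    rw [padicValRat.mul (zpow_ne_zero _ hs') (zpow_ne_zero _ hr), padicValRat.zpow,
      padicValRat.zpow, padicValRat.of_nat, padicValNat.eq_zero_of_not_dvd hrs,
      padicValRat.self (Fact.out : r.Prime).one_lt]
    simp
  have h₂ (i j : ℤ) : padicValRat 2 ((3 : ℚ) ^ i * 2 ^ j) = j := by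
    exact_mod_cast val 2 3 (by norm_num) (by norm_num) i j
  have h₃ (i j : ℤ) : padicValRat 3 ((3 : ℚ) ^ i * 2 ^ j) = i := by
    rw [mul_comm]
    exact_mod_cast val 3 2 (by norm_num) (by norm_num) j i
  exact Prod.ext (by rw [← h₃ x.1 x.2, hℚ, h₃]) (by rw [← h₂ x.1 x.2, hℚ, h₂])

theorem norm_lt_of_sq_eq_four_mul_pow {a y : ℂ} {s : ℝ} {n : ℕ} (ha : s ^ 2 < ‖a‖ ^ n)
    (hy : y ^ 2 = 4 * a ^ n) : 2 * s < ‖y‖ := by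
  have h := congrArg norm hy
  rw [norm_pow, norm_mul, norm_pow, Complex.norm_ofNat] at h
  refine lt_of_pow_lt_pow_left₀ 2 (norm_nonneg y) ?_
  rw [h]
  linarith [mul_pow 2 s 2]

/-- The values excluded for the last term of a chain: the images of the critical values of the
Dickson polynomials under at most `n` iterations. -/
def excludedValues (a b : ℂ) (ℓ p n : ℕ) : Set ℂ :=
  ⋃ j ∈ Set.Iic n, (fun y ↦ (dickson 1 b p).eval y)^[j] ''
    {y | y ^ 2 = 4 * a ^ ℓ ∨ y ^ 2 = 4 * b ^ p}

theorem finite_excludedValues (a b : ℂ) (ℓ p n : ℕ) : (excludedValues a b ℓ p n).Finite := by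
  have hroots (c : ℂ) : {y : ℂ | y ^ 2 = c}.Finite := by
    refine (nthRoots 2 c).toFinset.finite_toSet.subset fun y hy ↦ ?_
    simpa [mem_nthRoots] using hy
  exact (Set.finite_Iic n).biUnion fun j _ ↦ ((hroots _).union (hroots _)).image _

/-- The polynomials `E_{ℓ-1}(·; d_q), E_{p-1}(·; d), E_{p-1}(·; d), …`. -/
def dicksonFactor (ℓ p : ℕ) : ℕ → Jtilde[X]
  | 0 => dickson 2 dq (ℓ - 1)
  | _ + 1 => dickson 2 dd (p - 1)

/-- The polynomials `D_ℓ(·; d_q), D_p(·; d), D_p(·; d), …`. -/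
def dicksonMap (ℓ p : ℕ) : ℕ → Jtilde[X]
  | 0 => dickson 1 dq ℓ
  | _ + 1 => dickson 1 dd p

theorem range_chainRelation_dickson (ℓ p : ℕ) :
    Set.range (chainRelation (dicksonFactor ℓ p) (dicksonMap ℓ p)) =
      insert
        (aeval (MvPolynomial.X 0 : MvPolynomial ℕ Jtilde) (dickson 2 dq (ℓ - 1)) *
          (MvPolynomial.X 1 -
            aeval (MvPolynomial.X 0 : MvPolynomial ℕ Jtilde) (dickson 1 dq ℓ)))
        {f : MvPolynomial ℕ Jtilde | ∃ i : ℕ,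
          f = aeval (MvPolynomial.X (i + 1) : MvPolynomial ℕ Jtilde) (dickson 2 dd (p - 1)) *
              (MvPolynomial.X (i + 2) -
                aeval (MvPolynomial.X (i + 1) : MvPolynomial ℕ Jtilde) (dickson 1 dd p))} := by
  ext f
  constructor
  · rintro ⟨_ | i, rfl⟩
    · exact Or.inl rfl
    · exact Or.inr ⟨i, rfl⟩
  · rintro (rfl | ⟨i, rfl⟩)
    · exact ⟨0, rfl⟩
    · exact ⟨i + 1, rfl⟩

theorem IsChainFrom.iterate_dickson {a b : ℂˣ} {ℓ p : ℕ} {s : ℝ} (hs : 1 ≤ s)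
    (hb : ‖(b : ℂ)‖ = s ^ 2) {m : ℕ} {v : ℕ → ℂ}
    (hv : IsChainFrom (dicksonFactor ℓ (p + 2)) (dicksonMap ℓ (p + 2)) (specialization a b)
      (m + 1) v) (hm : 2 * s < ‖v (m + 1)‖) (j : ℕ) :
    v (m + 1 + j) = (fun y ↦ (dickson 1 (b : ℂ) (p + 2)).eval y)^[j] (v (m + 1)) ∧
      2 * s < ‖v (m + 1 + j)‖ := by
  induction j with
  | zero => exact ⟨rfl, hm⟩
  | succ j ih =>
    have h := hv (m + j + 1) (by omega)
    simp only [dicksonFactor, dicksonMap, ← eval_map, map_dickson, specialization_dd] at h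
    have hidx : m + j + 1 = m + 1 + j := by omega
    rw [hidx] at h
    have hstep := h.resolve_left (eval_dickson_two_ne_zero hs hb ih.2 p)
    rw [← add_assoc, Function.iterate_succ_apply', ← ih.1, hstep]
    exact ⟨rfl, norm_lt_norm_eval_dickson_one hs hb ih.2 (p + 1)⟩

theorem separable_of_notMem_excludedValues {a b : ℂˣ} {ℓ p n : ℕ} (hb : 1 < ‖(b : ℂ)‖)
    (hab : ‖(b : ℂ)‖ < ‖(a : ℂ)‖) {t : ℂ} (ht : t ∉ excludedValues a b (ℓ + 2) (p + 2) n)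
    {m : ℕ} (hm : m < n) {v : ℕ → ℂ} (hvt : v n = t)
    (hv : IsChainFrom (dicksonFactor (ℓ + 2) (p + 2)) (dicksonMap (ℓ + 2) (p + 2))
      (specialization a b) (m + 1) v) :
    ((dicksonFactor (ℓ + 2) (p + 2) m).map (specialization a b) *
      (C (v (m + 1)) - (dicksonMap (ℓ + 2) (p + 2) m).map (specialization a b))).Separable := by
  have hs : 1 ≤ √‖(b : ℂ)‖ := Real.one_le_sqrt.2 hb.le
  have hsq : ‖(b : ℂ)‖ = √‖(b : ℂ)‖ ^ 2 := (Real.sq_sqrt (norm_nonneg _)).symm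
  have hnot (hcrit : v (m + 1) ^ 2 = 4 * (a : ℂ) ^ (ℓ + 2) ∨
      v (m + 1) ^ 2 = 4 * (b : ℂ) ^ (p + 2)) (hlt : 2 * √‖(b : ℂ)‖ < ‖v (m + 1)‖) : False := by
    refine ht (Set.mem_biUnion (x := n - (m + 1)) (Nat.sub_le _ _) ⟨v (m + 1), hcrit, ?_⟩)
    rw [← (hv.iterate_dickson hs hsq hlt _).1, Nat.add_sub_cancel' hm, hvt]
  cases m with
  | zero =>
    simp only [dicksonFactor, dicksonMap, map_dickson, specialization_dq]
    refine separable_dickson_two_mul_sub_dickson_one a.ne_zero fun h ↦ hnot (Or.inl h) ?_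
    refine norm_lt_of_sq_eq_four_mul_pow ?_ h
    rw [← hsq]
    exact hab.trans_le (le_self_pow₀ (hb.trans hab).le (by omega))
  | succ m =>
    simp only [dicksonFactor, dicksonMap, map_dickson, specialization_dd]
    refine separable_dickson_two_mul_sub_dickson_one b.ne_zero fun h ↦ hnot (Or.inr h) ?_
    refine norm_lt_of_sq_eq_four_mul_pow ?_ h
    rw [← hsq]
    exact lt_self_pow₀ hb (by omega)

end Specialization

/-- Theorem 4.3: the ring `A` of twisted tilting modules of quantum `GL₂`, presented (via
Proposition 4.2) as `J̃[X₋₁, X₀, X₁, …]/I`, is a reduced ring.  Here the variable `X_i`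
(for `i ≥ -1`) is `MvPolynomial.X (i + 1)`, and `I` is the ideal generated by
`E_{ℓ-1}(X₋₁; d_q)·(X₀ − D_ℓ(X₋₁; d_q))` together with
`E_{p-1}(X_i; d)·(X_{i+1} − D_p(X_i; d))` for every `i ≥ 0`, where `D_n(·; a)` and
`E_n(·; a)` are the Dickson polynomials of the first and second kind. -/
theorem ring_of_twisted_tilting_modules_is_reduced (ℓ p : ℕ) (hℓ : 2 ≤ ℓ) (hp : 2 ≤ p) :
    IsReduced ((MvPolynomial ℕ Jtilde) ⧸ Ideal.span
      (insert
        (Polynomial.aeval (MvPolynomial.X 0 : MvPolynomial ℕ Jtilde)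
            (Polynomial.dickson 2 dq (ℓ - 1)) *
          (MvPolynomial.X 1 -
            Polynomial.aeval (MvPolynomial.X 0 : MvPolynomial ℕ Jtilde)
              (Polynomial.dickson 1 dq ℓ)))
        {f : MvPolynomial ℕ Jtilde | ∃ i : ℕ,
          f = Polynomial.aeval (MvPolynomial.X (i + 1) : MvPolynomial ℕ Jtilde)
                (Polynomial.dickson 2 dd (p - 1)) *
              (MvPolynomial.X (i + 2) -
                Polynomial.aeval (MvPolynomial.X (i + 1) : MvPolynomial ℕ Jtilde)
                  (Polynomial.dickson 1 dd p))})) := by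
  obtain ⟨ℓ, rfl⟩ := Nat.exists_eq_add_of_le' hℓ
  obtain ⟨p, rfl⟩ := Nat.exists_eq_add_of_le' hp
  rw [← range_chainRelation_dickson]
  let a (k : ℕ) : ℂˣ := Units.mk0 3 (by norm_num) ^ (k + 1)
  let b (k : ℕ) : ℂˣ := Units.mk0 2 (by norm_num) ^ (k + 1)
  have hb (k : ℕ) : ‖(b k : ℂ)‖ = 2 ^ (k + 1) := by simp [b]
  have ha (k : ℕ) : ‖(a k : ℂ)‖ = 3 ^ (k + 1) := by simp [a]
  refine isReduced_quotient_chainRelation (K := ℂ) ?_ ?_ ?_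
    (fun n ↦ {x | ∃ k, x.1 = specialization (a k) (b k) ∧
      x.2 ∉ excludedValues (a k) (b k) (ℓ + 2) (p + 2) n}) ?_ ?_
  · rintro (_ | i)
    · exact Polynomial.dickson_monic 2 dq ℓ.succ_ne_zero
    · exact Polynomial.dickson_monic 2 dd p.succ_ne_zero
  · rintro (_ | i)
    · exact Polynomial.dickson_monic 1 dq (ℓ + 1).succ_ne_zero
    · exact Polynomial.dickson_monic 1 dd (p + 1).succ_ne_zero
  · rintro (_ | i)
    · exact (Polynomial.natDegree_dickson 1 dq (ℓ + 1).succ_ne_zero).trans_ne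
        (ℓ + 1).succ_ne_zero
    · exact (Polynomial.natDegree_dickson 1 dd (p + 1).succ_ne_zero).trans_ne
        (p + 1).succ_ne_zero
  · intro n f hf
    refine Polynomial.ext fun j ↦
      eq_zero_of_forall_specialization_pow_eq_zero injective_three_zpow_mul_two_zpow fun k ↦ ?_
    have hmap : f.map (specialization (a k) (b k)) = 0 := by
      refine Polynomial.eq_zero_of_infinite_isRoot _
        ((finite_excludedValues (a k) (b k) (ℓ + 2) (p + 2) n).infinite_compl.mono fun t ht ↦ ?_)
      exact (Polynomial.eval_map _ _).trans (hf _ t ⟨k, rfl, ht⟩)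
    have h := congrArg (fun g ↦ g.coeff j) hmap
    simpa using h
  · rintro n _ t ⟨k, rfl, ht⟩ m hm v hvt hv
    refine separable_of_notMem_excludedValues ?_ ?_ ht hm hvt hv
    · rw [hb]
      exact one_lt_pow₀ one_lt_two k.succ_ne_zero
    · rw [hb, ha]
      exact pow_lt_pow_left₀ (by norm_num) (by norm_num) k.succ_ne_zero
end
end

section
/- Let ℓ ≥ 2 and p ≥ 2 be integers and let n ≥ 0. Let J̃ = ℤ[d_q^{±1}, d^{±1}] and consider the polynomial ring J̃[X_{-1}, X_0, …, X_n] in n+2 variables. Let I_n be the ideal generated by E_{ℓ-1}(X_{-1}; d_q)·(X_0 − D_ℓ(X_{-1}; d_q)) and the elements E_{p-1}(X_i; d)·(X_{i+1} − D_p(X_i; d)) for 0 ≤ i < n. Then the quotient ring J̃[X_{-1}, X_0, …, X_n]/I_n is a reduced ring. (This is the finite-level form of Theorem 4.3, via the presentation of the subring A_n of the ring of twisted tilting modules given in Proposition 4.2.) -/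
noncomputable section

open Polynomial

section PointSeparation

variable (J : Type*) (L : Type*) [CommRing J] [Field L] [Algebra J L]

/-- An ideal `I` of a `J`-algebra `R` is the vanishing ideal of its set of `L`-points. -/
def IsVanishingIdeal {R : Type*} [CommRing R] [Algebra J R] (I : Ideal R) : Prop :=
  ∀ r : R, (∀ φ : R →ₐ[J] L, (∀ x ∈ I, φ x = 0) → φ r = 0) → r ∈ I

variable {J L} {R : Type*} [CommRing R] [Algebra J R]

theorem IsVanishingIdeal.isRadical {I : Ideal R} (hI : IsVanishingIdeal J L I) :
    I.IsRadical := by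
  rintro r ⟨n, hn⟩
  exact hI r fun φ hφ ↦ eq_zero_of_pow_eq_zero (n := n) (by simpa using hφ _ hn)

theorem IsVanishingIdeal.map_algEquiv {A : Type*} [CommRing A] [Algebra J A] {I : Ideal R}
    (hI : IsVanishingIdeal J L I) (e : R ≃ₐ[J] A) :
    IsVanishingIdeal J L (I.map (e : R →+* A)) := by
  intro r hr
  have h : e.symm r ∈ I := by
    refine hI _ fun φ hφ ↦ hr (φ.comp e.symm) fun x hx ↦ ?_
    have hle : I.map (e : R →+* A) ≤ RingHom.ker (φ.comp e.symm.toAlgHom) :=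
      Ideal.map_le_iff_le_comap.2 fun y hy ↦ by simpa [RingHom.mem_ker] using hφ y hy
    exact hle hx
  simpa using Ideal.mem_map_of_mem (e : R →+* A) h

theorem isVanishingIdeal_bot [FaithfulSMul J L] : IsVanishingIdeal J L (⊥ : Ideal J) := by
  intro r hr
  have := hr (Algebra.ofId J L) (by simp)
  simpa [Algebra.ofId_apply] using this

/-- The `L`-point of `R[X]` lying over the `L`-point `φ` of `R`, with last coordinate `y`. -/
noncomputable def evalOver (φ : R →ₐ[J] L) (y : L) : R[X] →ₐ[J] L :=
  ((aeval y : L[X] →ₐ[L] L).restrictScalars J).comp (mapAlgHom φ)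

theorem evalOver_apply (φ : R →ₐ[J] L) (y : L) (f : R[X]) :
    evalOver φ y f = (f.map (φ : R →+* L)).eval y := by
  simp [evalOver, coe_aeval_eq_eval]

@[simp] theorem evalOver_C (φ : R →ₐ[J] L) (y : L) (r : R) : evalOver φ y (C r) = φ r := by
  simp [evalOver_apply]

@[simp] theorem evalOver_X (φ : R →ₐ[J] L) (y : L) : evalOver φ y X = y := by
  simp [evalOver_apply]

theorem evalOver_map_C (φ : R →ₐ[J] L) (y : L) {I : Ideal R} (hφ : ∀ x ∈ I, φ x = 0) :
    I.map C ≤ RingHom.ker (evalOver φ y) :=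
  Ideal.map_le_iff_le_comap.2 fun x hx ↦ by simpa [RingHom.mem_ker] using hφ x hx

theorem IsVanishingIdeal.map_C [Infinite L] {I : Ideal R} (hI : IsVanishingIdeal J L I) :
    IsVanishingIdeal J L (I.map (C : R →+* R[X])) := by
  intro f hf
  refine Ideal.mem_map_C_iff.2 fun n ↦ hI _ fun φ hφ ↦ ?_
  have h : f.map (φ : R →+* L) = 0 := Polynomial.funext fun y ↦ by
    simpa [evalOver_apply] using hf (evalOver φ y) fun x hx ↦ evalOver_map_C φ y hφ hx
  simpa using congr_arg (fun g ↦ coeff g n) h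

/-- Adjoining a root of a monic polynomial which is separable over `L` preserves being a
vanishing ideal. -/
theorem IsVanishingIdeal.map_C_sup_span [IsAlgClosed L] {I : Ideal R}
    (hI : IsVanishingIdeal J L I) {F : J[X]} (hF : F.Monic)
    (hsep : (F.map (algebraMap J L)).Separable) :
    IsVanishingIdeal J L (I.map (C : R →+* R[X]) ⊔ Ideal.span {aeval (X : R[X]) F}) := by
  classical
  intro f hf
  have hFR : aeval (X : R[X]) F = F.map (algebraMap J R) := by
    rw [aeval_def, eval₂_eq_eval_map, IsScalarTower.algebraMap_eq J R R[X], ← map_map,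
      Polynomial.algebraMap_eq, ← eval₂_eq_eval_map, eval₂_C_X]
  set G := F.map (algebraMap J R) with hG
  have hGm : G.Monic := hF.map _
  have hmod : f %ₘ G ∈ I.map (C : R →+* R[X]) := by
    refine Ideal.mem_map_C_iff.2 fun n ↦ hI _ fun φ hφ ↦ ?_
    have hGφ : G.map (φ : R →+* L) = F.map (algebraMap J L) := by
      rw [hG, map_map, AlgHom.comp_algebraMap]
    have h : (f %ₘ G).map (φ : R →+* L) = 0 := by
      rw [map_modByMonic _ hGm, modByMonic_eq_zero_iff_dvd (hGm.map _), hGφ]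
      by_cases hf0 : f.map (φ : R →+* L) = 0
      · simp [hf0]
      refine (IsAlgClosed.splits _).dvd_of_roots_le_roots hsep.ne_zero ?_
      rw [Multiset.le_iff_subset (nodup_roots hsep)]
      intro y hy
      rw [mem_roots hf0, IsRoot.def, ← evalOver_apply]
      refine hf _ fun x hx ↦ ?_
      have hle : I.map (C : R →+* R[X]) ⊔ Ideal.span {aeval (X : R[X]) F} ≤
          RingHom.ker (evalOver φ y) := by
        refine sup_le (evalOver_map_C φ y hφ) ?_
        rw [Ideal.span_singleton_le_iff_mem, RingHom.mem_ker, ← aeval_algHom_apply, evalOver_X,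
          aeval_def, eval₂_eq_eval_map]
        exact isRoot_of_mem_roots hy
      exact hle hx
    simpa using congr_arg (fun g ↦ coeff g n) h
  rw [hFR, ← modByMonic_add_div f G]
  exact add_mem (Ideal.mem_sup_left hmod)
    (Ideal.mem_sup_right (Ideal.mul_mem_right _ _ (Ideal.mem_span_singleton_self _)))

/-- Vanishing ideals for a union of two pieces: the graph `X = h` over the locus of `I`, and the
cylinder over the locus of `I` and `c`, both cut by `F(X) = 0`. -/
theorem IsVanishingIdeal.sup_span_mul_sub {I : Ideal R} {c h : R} {F : J[X]}
    (hgraph : IsVanishingIdeal J L (I ⊔ Ideal.span {aeval h F}))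
    (hcyl : IsVanishingIdeal J L
      ((I ⊔ Ideal.span {c}).map (C : R →+* R[X]) ⊔ Ideal.span {aeval (X : R[X]) F}))
    (hreg : ∀ g : R[X],
      (X - C h) * g ∈
        (I ⊔ Ideal.span {c}).map (C : R →+* R[X]) ⊔ Ideal.span {aeval (X : R[X]) F} →
      g ∈ (I ⊔ Ideal.span {c}).map (C : R →+* R[X]) ⊔ Ideal.span {aeval (X : R[X]) F}) :
    IsVanishingIdeal J L (I.map (C : R →+* R[X]) ⊔ Ideal.span {C c * (X - C h)} ⊔
      Ideal.span {aeval (X : R[X]) F}) := by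
  intro f hf
  set T := I.map (C : R →+* R[X]) ⊔ Ideal.span {C c * (X - C h)} ⊔
      Ideal.span {aeval (X : R[X]) F} with hT
  set K := (I ⊔ Ideal.span {c}).map (C : R →+* R[X]) ⊔ Ideal.span {aeval (X : R[X]) F} with hK
  have hIT : I.map (C : R →+* R[X]) ≤ T := le_sup_left.trans le_sup_left
  have hFT : aeval (X : R[X]) F ∈ T := Ideal.mem_sup_right (Ideal.mem_span_singleton_self _)
  have hcT : C c * (X - C h) ∈ T :=
    Ideal.mem_sup_left (Ideal.mem_sup_right (Ideal.mem_span_singleton_self _))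
  have hTK : T ≤ K := by
    refine sup_le (sup_le ((Ideal.map_mono le_sup_left).trans le_sup_left) ?_) le_sup_right
    rw [Ideal.span_singleton_le_iff_mem]
    exact Ideal.mem_sup_left (Ideal.mul_mem_right _ _ (Ideal.mem_map_of_mem _
      (Ideal.mem_sup_right (Ideal.mem_span_singleton_self _))))
  have hgraph' : ∃ g, f - (X - C h) * g ∈ T := by
    have hfh : f.eval h ∈ I ⊔ Ideal.span {aeval h F} := by
      refine hgraph _ fun φ hφ ↦ ?_
      have := hf (evalOver φ (φ h)) fun x hx ↦ ?_
      · rw [evalOver_apply, eval_map] at this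
        exact (eval₂_hom (φ : R →+* L) h).symm.trans this
      · have hle : T ≤ RingHom.ker (evalOver φ (φ h)) := by
          refine sup_le (sup_le (evalOver_map_C φ _ fun x hx ↦ hφ x (Ideal.mem_sup_left hx)) ?_) ?_
          · simp [RingHom.mem_ker]
          · rw [Ideal.span_singleton_le_iff_mem, RingHom.mem_ker, ← aeval_algHom_apply,
              evalOver_X, aeval_algHom_apply]
            exact hφ _ (Ideal.mem_sup_right (Ideal.mem_span_singleton_self _))
        exact hle hx
    obtain ⟨i, hi, j, hj, hij⟩ := Submodule.mem_sup.1 hfh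
    obtain ⟨u, rfl⟩ := Ideal.mem_span_singleton'.1 hj
    obtain ⟨v, hv⟩ := X_sub_C_dvd_sub_C_eval (a := h) (p := f)
    have hFh : (X - C h) ∣ aeval (X : R[X]) F - C (aeval h F) := by
      rw [show C (aeval h F) = aeval (C h) F by
        simpa [Polynomial.algebraMap_eq] using (aeval_algebraMap_apply R[X] h F).symm]
      rw [aeval_def, aeval_def, eval₂_eq_eval_map, eval₂_eq_eval_map]
      exact sub_dvd_eval_sub _ _ _
    obtain ⟨w, hw⟩ := hFh
    refine ⟨v - C u * w, ?_⟩
    have : f - (X - C h) * (v - C u * w) = C i + C u * aeval (X : R[X]) F := by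
      rw [mul_sub, ← hv, mul_left_comm, ← hw, ← hij, C_add, C_mul]
      ring
    rw [this]
    exact add_mem (hIT (Ideal.mem_map_of_mem _ hi)) (Ideal.mul_mem_left _ _ hFT)
  obtain ⟨g, hg⟩ := hgraph'
  have hgK : g ∈ K := hreg _ <| hcyl _ fun ψ hψ ↦ by
    have h₁ := hf ψ fun x hx ↦ hψ x (hTK hx)
    have h₂ := hψ _ (hTK hg)
    rw [map_sub, h₁, zero_sub, neg_eq_zero] at h₂
    exact h₂
  have hgT : (X - C h) * g ∈ T := by
    have hle : K ≤ Submodule.comap (LinearMap.mulLeft R[X] (X - C h)) T := by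
      rw [hK, Ideal.map_sup, Ideal.map_span, Set.image_singleton]
      refine sup_le (sup_le (fun x hx ↦ Ideal.mul_mem_left _ _ (hIT hx)) ?_) ?_
      · rw [Ideal.span_singleton_le_iff_mem, Submodule.mem_comap, LinearMap.mulLeft_apply, mul_comm]
        exact hcT
      · rw [Ideal.span_singleton_le_iff_mem]
        exact Ideal.mul_mem_left _ _ hFT
    exact hle hgK
  simpa using add_mem hg hgT

theorem mem_map_C_of_X_sub_C_mul_mem {I : Ideal R} {h : R} {g : R[X]}
    (hg : (X - C h) * g ∈ I.map (C : R →+* R[X])) : g ∈ I.map (C : R →+* R[X]) := by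
  rw [← Ideal.mk_ker (I := I), ← ker_mapRingHom, RingHom.mem_ker, coe_mapRingHom] at hg ⊢
  rw [Polynomial.map_mul] at hg
  exact (((monic_X_sub_C h).map _).mul_right_eq_zero_iff).1 hg

theorem mem_sup_span_of_X_sub_C_mul_mem {I : Ideal R} {h : R} {F : J[X]}
    (hI : IsVanishingIdeal J L (I.map (C : R →+* R[X]) ⊔ Ideal.span {aeval (X : R[X]) F}))
    (hF : ∀ φ : R →ₐ[J] L, (∀ x ∈ I, φ x = 0) → aeval (φ h) F ≠ 0) {g : R[X]}
    (hg : (X - C h) * g ∈ I.map (C : R →+* R[X]) ⊔ Ideal.span {aeval (X : R[X]) F}) :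
    g ∈ I.map (C : R →+* R[X]) ⊔ Ideal.span {aeval (X : R[X]) F} := by
  refine hI _ fun ψ hψ ↦ (mul_eq_zero.1 ((map_mul ψ _ _).symm.trans (hψ _ hg))).resolve_left
    fun h₀ ↦ ?_
  rw [map_sub, sub_eq_zero] at h₀
  refine hF (ψ.comp CAlgHom) (fun x hx ↦ hψ _ (Ideal.mem_sup_left (Ideal.mem_map_of_mem _ hx))) ?_
  have := hψ _ (Ideal.mem_sup_right (Ideal.mem_span_singleton_self _))
  rw [← aeval_algHom_apply, h₀] at this
  exact this

variable (J) in
/-- Adjoining the last variable: `J[X₀, …, Xₙ₋₁][Xₙ] ≃ J[X₀, …, Xₙ]`. -/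
noncomputable def lastVariableEquiv (n : ℕ) :
    (MvPolynomial (Fin n) J)[X] ≃ₐ[J] MvPolynomial (Fin (n + 1)) J :=
  (MvPolynomial.optionEquivLeft J (Fin n)).symm.trans
    (MvPolynomial.renameEquiv J finSuccEquivLast.symm)

theorem lastVariableEquiv_X (n : ℕ) :
    lastVariableEquiv J n X = MvPolynomial.X (Fin.last n) := by
  simp [lastVariableEquiv, MvPolynomial.optionEquivLeft_symm_X]

theorem lastVariableEquiv_C_X (n : ℕ) (i : Fin n) :
    lastVariableEquiv J n (C (MvPolynomial.X i)) = MvPolynomial.X i.castSucc := by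
  simp [lastVariableEquiv, MvPolynomial.optionEquivLeft_symm_C_X]

theorem lastVariableEquiv_aeval_X (n : ℕ) (F : J[X]) :
    lastVariableEquiv J n (aeval X F) = aeval (MvPolynomial.X (Fin.last n)) F := by
  rw [← lastVariableEquiv_X, aeval_algHom_apply]

theorem lastVariableEquiv_C_aeval_X (n : ℕ) (i : Fin n) (F : J[X]) :
    lastVariableEquiv J n (C (aeval (MvPolynomial.X i) F)) =
      aeval (MvPolynomial.X i.castSucc) F := by
  rw [← lastVariableEquiv_C_X, aeval_algHom_apply]
  exact congr_arg _ (aeval_algHom_apply CAlgHom _ _).symm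

/-- The ideal of `J[X₀, …, Xₙ]` generated by the `c_i(X_i) (X_{i+1} - h_i(X_i))` for `i < n`. -/
noncomputable def chainIdeal (c h : ℕ → J[X]) (n : ℕ) : Ideal (MvPolynomial (Fin (n + 1)) J) :=
  Ideal.span (Set.range fun i : Fin n ↦
    aeval (MvPolynomial.X i.castSucc : MvPolynomial (Fin (n + 1)) J) (c i) *
      (MvPolynomial.X i.succ - aeval (MvPolynomial.X i.castSucc) (h i)))

theorem chainIdeal_succ (c h : ℕ → J[X]) (n : ℕ) :
    chainIdeal c h (n + 1) =
      ((chainIdeal c h n).map C ⊔ Ideal.span {C (aeval (MvPolynomial.X (Fin.last n)) (c n)) *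
        (X - C (aeval (MvPolynomial.X (Fin.last n)) (h n)))}).map
          (lastVariableEquiv J (n + 1) : _ →+* _) := by
  simp only [chainIdeal, Ideal.map_sup, Ideal.map_span, ← Set.range_comp, Set.image_singleton]
  rw [← Ideal.span_union]
  congr 1
  ext f
  simp only [Set.mem_range, Set.mem_union, Set.mem_singleton_iff, Fin.exists_fin_succ',
    Function.comp_apply, map_mul, map_sub, RingHom.coe_coe, lastVariableEquiv_C_aeval_X,
    lastVariableEquiv_C_X, lastVariableEquiv_X, Fin.val_castSucc, Fin.val_last, Fin.succ_castSucc,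
    Fin.succ_last, eq_comm (a := f)]

theorem chainIdeal_succ_eq_span_insert (c h : ℕ → J[X]) (n : ℕ) :
    chainIdeal c h (n + 1) = Ideal.span
      (insert (aeval (MvPolynomial.X 0 : MvPolynomial (Fin (n + 2)) J) (c 0) *
          (MvPolynomial.X 1 - aeval (MvPolynomial.X 0) (h 0)))
        {f | ∃ i : Fin n, f = aeval (MvPolynomial.X i.castSucc.succ) (c (i + 1)) *
          (MvPolynomial.X i.succ.succ - aeval (MvPolynomial.X i.castSucc.succ) (h (i + 1)))}) := by
  rw [chainIdeal]
  congr 1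
  ext f
  simp only [Set.mem_insert_iff, Set.mem_ofPred_eq, Set.mem_range, Fin.exists_fin_succ,
    Fin.val_zero, Fin.val_succ, Fin.castSucc_zero, Fin.succ_zero_eq_one, Fin.castSucc_succ,
    eq_comm (b := f)]

theorem isVanishingIdeal_chainIdeal_sup_span [FaithfulSMul J L] [IsAlgClosed L]
    {S : Set J[X]} {c h : ℕ → J[X]} (hmonic : ∀ F ∈ S, F.Monic)
    (hsep : ∀ F ∈ S, (F.map (algebraMap J L)).Separable) (hc : ∀ i, c i ∈ S)
    (hcomp : ∀ F ∈ S, ∀ i, F.comp (h i) ∈ S)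
    (hcop : ∀ F ∈ S, ∀ i, ∀ z : L, aeval z (c i) = 0 → aeval z (F.comp (h i)) ≠ 0)
    (n : ℕ) {F : J[X]} (hF : F = 0 ∨ F ∈ S) :
    IsVanishingIdeal J L
      (chainIdeal c h n ⊔ Ideal.span {aeval (MvPolynomial.X (Fin.last n)) F}) := by
  have hcyl {A : Type _} [CommRing A] [Algebra J A] {I : Ideal A} (hI : IsVanishingIdeal J L I)
      {F : J[X]} (hF : F = 0 ∨ F ∈ S) :
      IsVanishingIdeal J L (I.map (C : A →+* A[X]) ⊔ Ideal.span {aeval (X : A[X]) F}) := by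
    obtain rfl | hF := hF
    · have := IsAlgClosed.instInfinite (K := L)
      simpa using hI.map_C
    · exact hI.map_C_sup_span (hmonic F hF) (hsep F hF)
  induction n generalizing F with
  | zero =>
    have h₀ : IsVanishingIdeal J L (⊥ : Ideal (MvPolynomial (Fin 0) J)) := by
      simpa [Ideal.map_bot] using (isVanishingIdeal_bot (J := J) (L := L)).map_algEquiv
        (MvPolynomial.isEmptyAlgEquiv J (Fin 0)).symm
    have := (hcyl h₀ hF).map_algEquiv (lastVariableEquiv J 0)
    simpa [Ideal.map_bot, Ideal.map_span, chainIdeal, lastVariableEquiv_aeval_X] using this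
  | succ n ih =>
    have hK := hcyl (ih (Or.inr (hc n))) hF
    have hgraph : IsVanishingIdeal J L (chainIdeal c h n ⊔
        Ideal.span {aeval (aeval (MvPolynomial.X (Fin.last n)) (h n)) F}) := by
      rw [← aeval_comp]
      exact ih (hF.imp (by rintro rfl; simp) (hcomp F · n))
    have := (IsVanishingIdeal.sup_span_mul_sub hgraph hK ?_).map_algEquiv
      (lastVariableEquiv J (n + 1))
    · rw [chainIdeal_succ]
      rwa [Ideal.map_sup, Ideal.map_span _ {_}, Set.image_singleton, RingHom.coe_coe,
        lastVariableEquiv_aeval_X] at this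
    · intro g hg
      obtain rfl | hF := hF
      · simp only [map_zero, Ideal.span_singleton_zero, sup_bot_eq] at hg ⊢
        exact mem_map_C_of_X_sub_C_mul_mem hg
      · refine mem_sup_span_of_X_sub_C_mul_mem hK (fun φ hφ ↦ ?_) hg
        rw [← aeval_algHom_apply, ← aeval_comp]
        refine hcop F hF n _ ?_
        rw [aeval_algHom_apply]
        exact hφ _ (Ideal.mem_sup_right (Ideal.mem_span_singleton_self _))

theorem chainIdeal_isRadical [FaithfulSMul J L] [IsAlgClosed L]
    {S : Set J[X]} {c h : ℕ → J[X]} (hmonic : ∀ F ∈ S, F.Monic)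
    (hsep : ∀ F ∈ S, (F.map (algebraMap J L)).Separable) (hc : ∀ i, c i ∈ S)
    (hcomp : ∀ F ∈ S, ∀ i, F.comp (h i) ∈ S)
    (hcop : ∀ F ∈ S, ∀ i, ∀ z : L, aeval z (c i) = 0 → aeval z (F.comp (h i)) ≠ 0) (n : ℕ) :
    (chainIdeal c h n).IsRadical := by
  simpa using (isVanishingIdeal_chainIdeal_sup_span hmonic hsep hc hcomp hcop n
    (F := 0) (Or.inl rfl)).isRadical

end PointSeparation

section Specialization

variable {J k : Type*} [CommRing J] [Field k]

/-- Coprimality after specializing the coefficients implies that a nonzero constant is a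
combination of the two polynomials. -/
theorem exists_mul_add_mul_eq_C_of_isCoprime_map (ρ : J →+* k) {f g : J[X]} (hf : f.Monic)
    (h : IsCoprime (f.map ρ) (g.map ρ)) : ∃ r ≠ 0, ∃ a b, f * a + g * b = C r := by
  by_cases hd : f.natDegree = 0
  · have : Nontrivial J := ρ.domain_nontrivial
    exact ⟨1, one_ne_zero, 1, 0, by simp [hf.natDegree_eq_zero.1 hd]⟩
  obtain ⟨a, b, -, -, hab⟩ := exists_mul_add_mul_eq_C_resultant f g le_rfl le_rfl (Or.inl hd)
  refine ⟨_, fun h₀ ↦ ?_, a, b, hab⟩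
  have h₁ := resultant_add_right_deg (f.map ρ) (g.map ρ) f.natDegree _
    (g.natDegree - (g.map ρ).natDegree) le_rfl
  rw [Nat.add_sub_cancel' natDegree_map_le, resultant_map_map, h₀, map_zero, coeff_map,
    hf.coeff_natDegree, map_one, one_pow, one_mul, ← hf.natDegree_map ρ] at h₁
  exact resultant_ne_zero _ _ h h₁.symm

theorem isCoprime_map_of_isCoprime_map {L : Type*} [Field L] (ρ : J →+* k) {ι : J →+* L}
    (hι : Function.Injective ι) {f g : J[X]} (hf : f.Monic)
    (h : IsCoprime (f.map ρ) (g.map ρ)) : IsCoprime (f.map ι) (g.map ι) := by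
  obtain ⟨r, hr, a, b, hab⟩ := exists_mul_add_mul_eq_C_of_isCoprime_map ρ hf h
  have hr' : ι r ≠ 0 := by simpa using hι.ne hr
  refine ⟨C (ι r)⁻¹ * a.map ι, C (ι r)⁻¹ * b.map ι, ?_⟩
  have := congr_arg (Polynomial.map ι) hab
  simp only [Polynomial.map_add, Polynomial.map_mul, map_C] at this
  calc _ = C (ι r)⁻¹ * (f.map ι * a.map ι + g.map ι * b.map ι) := by ring
    _ = 1 := by rw [this, ← C_mul, inv_mul_cancel₀ hr', C_1]

end Specialization

section Dickson

theorem dickson_succ_monic_and_natDegree {R : Type*} [CommRing R] [Nontrivial R] (k : ℕ) (a : R)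
    (n : ℕ) : (dickson k a (n + 1)).Monic ∧ (dickson k a (n + 1)).natDegree = n + 1 := by
  induction n using Nat.twoStepInduction with
  | zero => simp
  | one =>
    have h : dickson k a 2 = X ^ 2 + C (-(a * (3 - k))) := by
      rw [dickson_two]
      simp [sub_eq_add_neg, ← C_ofNat]
    rw [h]
    exact ⟨monic_X_pow_add_C _ two_ne_zero, natDegree_X_pow_add_C⟩
  | more n ih₁ ih₂ =>
    have hX : (X * dickson k a (n + 2)).Monic := monic_X.mul ih₂.1
    have hd : (X * dickson k a (n + 2)).natDegree = n + 3 := by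
      rw [monic_X.natDegree_mul ih₂.1, natDegree_X, ih₂.2]
      ring
    have hlt : (C a * dickson k a (n + 1)).natDegree < (X * dickson k a (n + 2)).natDegree := by
      rw [hd]
      exact (natDegree_C_mul_le _ _).trans_lt (by rw [ih₁.2]; lia)
    rw [dickson_add_two]
    exact ⟨hX.sub_of_left (degree_lt_degree hlt), by
      rw [natDegree_sub_eq_left_of_natDegree_lt hlt, hd]⟩

theorem dickson_two_monic {R : Type*} [CommRing R] [Nontrivial R] (a : R) (n : ℕ) :
    (dickson 2 a n).Monic := by
  cases n with
  | zero =>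
    have : (dickson 2 a 0) = 1 := by rw [dickson_zero]; norm_num
    exact this ▸ monic_one
  | succ n => exact (dickson_succ_monic_and_natDegree 2 a n).1

section

variable {R : Type*} [CommRing R]

theorem dickson_one_one_succ_eq (n : ℕ) :
    dickson 1 (1 : R) (n + 1) = 2 * dickson 2 1 (n + 1) - X * dickson 2 1 n := by
  rw [dickson_one_one_eq_chebyshev_C, dickson_two_one_eq_chebyshev_S,
    dickson_two_one_eq_chebyshev_S, Chebyshev.C_eq_S_sub_X_mul_S]
  simp

theorem dickson_one_one_succ_sq_sub_four (n : ℕ) :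
    dickson 1 (1 : R) (n + 1) ^ 2 - 4 = (X ^ 2 - 4) * dickson 2 1 n ^ 2 := by
  have h := Chebyshev.S_sq_add_S_sq R n
  have h₁ := dickson_two_one_eq_chebyshev_S R (n + 1)
  push_cast at h₁
  rw [← h₁, ← dickson_two_one_eq_chebyshev_S] at h
  rw [dickson_one_one_succ_eq]
  linear_combination 4 * h

theorem derivative_dickson_one_one_succ (n : ℕ) :
    derivative (dickson 1 (1 : R) (n + 1)) = ((n : R[X]) + 1) * dickson 2 1 n := by
  induction n using Nat.twoStepInduction with
  | zero =>
    simp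
    norm_num
  | one =>
    simp
    ring
  | more n ih₁ ih₂ =>
    have h := dickson_one_one_succ_eq (R := R) (n + 1)
    have hS := dickson_add_two 2 (1 : R) n
    simp only [C_1, one_mul] at hS
    rw [dickson_add_two, derivative_sub, derivative_mul, C_1, one_mul, derivative_X, ih₁, ih₂]
    rw [add_assoc n 1 1, one_add_one_eq_two] at h ⊢
    rw [hS] at h ⊢
    push_cast
    linear_combination h

theorem succ_mul_dickson_one_one_succ [IsDomain R] [CharZero R] (n : ℕ) :
    ((n : R[X]) + 1) * dickson 1 1 (n + 1) =
      X * dickson 2 1 n + (X ^ 2 - 4) * derivative (dickson 2 1 n) := by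
  have h := congr_arg derivative (dickson_one_one_succ_sq_sub_four (R := R) n)
  simp only [derivative_sub, derivative_mul, derivative_pow, derivative_dickson_one_one_succ,
    derivative_X, derivative_ofNat] at h
  have h₂ : (2 : R[X]) * dickson 2 1 n ≠ 0 := mul_ne_zero two_ne_zero (dickson_two_monic _ _).ne_zero
  refine mul_left_cancel₀ h₂ ?_
  norm_num [C_ofNat] at h
  linear_combination h

end

variable {k : Type*} [Field k]

theorem isCoprime_iff_eval_ne_zero [IsAlgClosed k] {f g : k[X]} :
    IsCoprime f g ↔ ∀ z, f.eval z = 0 → g.eval z ≠ 0 := by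
  rw [isCoprime_iff_aeval_ne_zero_of_isAlgClosed k k]
  simp [coe_aeval_eq_eval, imp_iff_not_or]

theorem eval_dickson_one_one_sq (n : ℕ) {z : k}
    (hz : z ^ 2 = 4 ∨ (dickson 2 1 n).eval z = 0) :
    (dickson 1 1 (n + 1)).eval z ^ 2 = 4 := by
  have h := congr_arg (eval z) (dickson_one_one_succ_sq_sub_four (R := k) n)
  simp only [eval_sub, eval_pow, eval_mul, eval_X, eval_ofNat] at h
  rcases hz with hz | hz <;> rw [hz] at h <;> linear_combination h

theorem isCoprime_comp_dickson [IsAlgClosed k] {f : k[X]} (hf : ∀ z, z ^ 2 = 4 → f.eval z ≠ 0) (n : ℕ) :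
    IsCoprime (f.comp (dickson 1 1 (n + 1))) (dickson 2 1 n) := by
  refine isCoprime_iff_eval_ne_zero.2 fun z hz hz' ↦ ?_
  rw [eval_comp] at hz
  exact hf _ (eval_dickson_one_one_sq n (Or.inr hz')) hz

variable [CharZero k]

theorem succ_mul_eval_dickson_one_one (n : ℕ) (z : k) :
    ((n : k) + 1) * (dickson 1 1 (n + 1)).eval z =
      z * (dickson 2 1 n).eval z + (z ^ 2 - 4) * (derivative (dickson 2 1 n)).eval z := by
  simpa using congr_arg (eval z) (succ_mul_dickson_one_one_succ (R := k) n)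

theorem eval_dickson_two_one_ne_zero (n : ℕ) {z : k} (hz : z ^ 2 = 4) :
    (dickson 2 1 n).eval z ≠ 0 := by
  intro h₀
  have h := succ_mul_eval_dickson_one_one n z
  rw [h₀, hz, sub_self, zero_mul, mul_zero, add_zero] at h
  have h₁ := eval_dickson_one_one_sq n (Or.inl hz)
  rw [(mul_eq_zero.1 h).resolve_left n.cast_add_one_ne_zero] at h₁
  norm_num at h₁

variable [IsAlgClosed k]

theorem separable_dickson_two_one (n : ℕ) : (dickson 2 (1 : k) n).Separable := by
  refine isCoprime_iff_eval_ne_zero.2 fun z hz hz' ↦ ?_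
  have h := succ_mul_eval_dickson_one_one n z
  rw [hz, hz', mul_zero, mul_zero, add_zero] at h
  have h₁ := eval_dickson_one_one_sq n (Or.inr hz)
  rw [(mul_eq_zero.1 h).resolve_left n.cast_add_one_ne_zero] at h₁
  norm_num at h₁

theorem separable_comp_dickson {f : k[X]} (hsep : f.Separable)
    (hf : ∀ z, z ^ 2 = 4 → f.eval z ≠ 0) (n : ℕ) :
    (f.comp (dickson 1 1 (n + 1))).Separable := by
  rw [separable_def, derivative_comp, derivative_dickson_one_one_succ]
  refine IsCoprime.mul_right (IsCoprime.mul_right ?_ (isCoprime_comp_dickson hf n)) ?_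
  · exact isCoprime_iff_eval_ne_zero.2 fun z _ ↦ by simpa using n.cast_add_one_ne_zero
  · exact isCoprime_iff_eval_ne_zero.2 fun z hz hz' ↦ by
      rw [eval_comp] at hz hz'
      exact isCoprime_iff_eval_ne_zero.1 hsep _ hz hz'

variable {J : Type*} [CommRing J]

/-- Monic polynomials whose specialization along `ρ` is separable and does not vanish
at `± 2`. -/
def separableAwayFromTwo (ρ : J →+* k) : Set J[X] :=
  {F | F.Monic ∧ (F.map ρ).Separable ∧ ∀ z : k, z ^ 2 = 4 → (F.map ρ).eval z ≠ 0}

variable {ρ : J →+* k}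

theorem dickson_two_mem_separableAwayFromTwo {a : J} (ha : ρ a = 1) (n : ℕ) :
    dickson 2 a n ∈ separableAwayFromTwo ρ := by
  have := ρ.domain_nontrivial
  refine ⟨dickson_two_monic a n, ?_⟩
  rw [map_dickson, ha]
  exact ⟨separable_dickson_two_one n, fun z ↦ eval_dickson_two_one_ne_zero n⟩

theorem comp_dickson_mem_separableAwayFromTwo {a : J} (ha : ρ a = 1) (n : ℕ) {F : J[X]}
    (hF : F ∈ separableAwayFromTwo ρ) :
    F.comp (dickson 1 a (n + 1)) ∈ separableAwayFromTwo ρ := by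
  have := ρ.domain_nontrivial
  obtain ⟨hm, hd⟩ := dickson_succ_monic_and_natDegree 1 a n
  refine ⟨hF.1.comp hm (by lia), ?_⟩
  rw [map_comp, map_dickson, ha]
  refine ⟨separable_comp_dickson hF.2.1 hF.2.2 n, fun z hz ↦ ?_⟩
  rw [eval_comp]
  exact hF.2.2 _ (eval_dickson_one_one_sq n (Or.inl hz))

/-- The ideal generated by the `E_{m_i}(X_i; a_i) (X_{i+1} - D_{m_i + 1}(X_i; a_i))` is radical as
soon as some specialization to characteristic zero sends every `a_i` to `1`. -/
theorem chainIdeal_dickson_isRadical [IsDomain J] (ρ : J →+* k) {a : ℕ → J}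
    (ha : ∀ i, ρ (a i) = 1) (m : ℕ → ℕ) (n : ℕ) :
    (chainIdeal (fun i ↦ dickson 2 (a i) (m i)) (fun i ↦ dickson 1 (a i) (m i + 1))
      n).IsRadical := by
  let L := AlgebraicClosure (FractionRing J)
  have hinj : Function.Injective (algebraMap J L) := by
    rw [IsScalarTower.algebraMap_eq J (FractionRing J) L]
    exact (algebraMap (FractionRing J) L).injective.comp (IsFractionRing.injective J _)
  have : FaithfulSMul J L := (faithfulSMul_iff_algebraMap_injective J L).2 hinj
  refine chainIdeal_isRadical (L := L) (S := separableAwayFromTwo ρ) (fun F hF ↦ hF.1)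
    (fun F hF ↦ ?_) (fun i ↦ dickson_two_mem_separableAwayFromTwo (ha i) _)
    (fun F hF i ↦ comp_dickson_mem_separableAwayFromTwo (ha i) _ hF) (fun F hF i z hz hz' ↦ ?_) n
  · rw [separable_def, derivative_map]
    refine isCoprime_map_of_isCoprime_map ρ hinj hF.1 ?_
    rw [← derivative_map]
    exact hF.2.1
  · have hcop : IsCoprime ((F.comp (dickson 1 (a i) (m i + 1))).map (algebraMap J L))
        ((dickson 2 (a i) (m i)).map (algebraMap J L)) := by
      refine isCoprime_map_of_isCoprime_map ρ hinj
        (comp_dickson_mem_separableAwayFromTwo (ha i) _ hF).1 ?_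
      rw [map_comp, map_dickson, map_dickson, ha]
      exact isCoprime_comp_dickson hF.2.2 _
    rw [aeval_def, eval₂_eq_eval_map] at hz hz'
    obtain ⟨u, v, huv⟩ := hcop
    simpa [hz, hz'] using congr_arg (eval z) huv

end Dickson

theorem exists_specialization_dq_dd : ∃ ρ : Jtilde →+* ℂ, ρ dq = 1 ∧ ρ dd = 1 :=
  ⟨(AddMonoidAlgebra.lift ℤ ℂ (ℤ × ℤ) 1).toRingHom, by simp [dq], by simp [dd]⟩

/-- The finite-level form of Theorem 4.3: the subring `Aₙ` of the ring of twisted tilting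
modules of quantum `GL₂`, presented (via Proposition 4.2) as
`J̃[X₋₁, X₀, …, Xₙ]/Iₙ`, is a reduced ring.  Here `J̃[X₋₁, X₀, …, Xₙ]` is the polynomial
ring in `n + 2` variables (the variable `X_i`, `-1 ≤ i ≤ n`, is `MvPolynomial.X (i + 1)`
indexed by `Fin (n + 2)`), and `Iₙ` is generated by
`E_{ℓ-1}(X₋₁; d_q)·(X₀ − D_ℓ(X₋₁; d_q))` together with
`E_{p-1}(X_i; d)·(X_{i+1} − D_p(X_i; d))` for `0 ≤ i < n`, where `D_m(·; a)` and
`E_m(·; a)` are the Dickson polynomials of the first and second kind. -/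
theorem ring_of_twisted_tilting_modules_level_n_is_reduced
    (ℓ p : ℕ) (hℓ : 2 ≤ ℓ) (hp : 2 ≤ p) (n : ℕ) :
    IsReduced ((MvPolynomial (Fin (n + 2)) Jtilde) ⧸ Ideal.span
      (insert
        (Polynomial.aeval (MvPolynomial.X 0 : MvPolynomial (Fin (n + 2)) Jtilde)
            (Polynomial.dickson 2 dq (ℓ - 1)) *
          (MvPolynomial.X 1 -
            Polynomial.aeval (MvPolynomial.X 0 : MvPolynomial (Fin (n + 2)) Jtilde)
              (Polynomial.dickson 1 dq ℓ)))
        {f : MvPolynomial (Fin (n + 2)) Jtilde | ∃ i : Fin n,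
          f = Polynomial.aeval
                (MvPolynomial.X i.castSucc.succ : MvPolynomial (Fin (n + 2)) Jtilde)
                (Polynomial.dickson 2 dd (p - 1)) *
              (MvPolynomial.X i.succ.succ -
                Polynomial.aeval
                  (MvPolynomial.X i.castSucc.succ : MvPolynomial (Fin (n + 2)) Jtilde)
                  (Polynomial.dickson 1 dd p))})) := by
  obtain ⟨ρ, hq, hd⟩ := exists_specialization_dq_dd
  rw [← Ideal.isRadical_iff_quotient_reduced]
  have h := chainIdeal_dickson_isRadical ρ (a := fun i ↦ if i = 0 then dq else dd)
    (fun i ↦ by split_ifs <;> assumption)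
    (fun i ↦ if i = 0 then ℓ - 1 else p - 1) (n + 1)
  simp only [chainIdeal_succ_eq_span_insert, if_true, Nat.succ_ne_zero, if_false,
    Nat.sub_add_cancel (one_le_two.trans hℓ), Nat.sub_add_cancel (one_le_two.trans hp)] at h
  exact h
end
end

section
/- Let ℓ ≥ 3 be an odd integer. Let K be the field of fractions of ℤ[d_q^{±1}, d^{±1}] (i.e. K = ℚ(d_q, d)), and let A_K(0) = K[X_{-1}, X_0]/(F), where F = E_{ℓ-1}(X_{-1}; d_q)·(X_0 − D_ℓ(X_{-1}; d_q)). Then for every integer b, the image of X_{-1} − b in A_K(0) is not a zero divisor. (This is Lemma 4.4 of the paper; ℓ is odd, the standard assumption on the order of the root of unity q.) -/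
noncomputable section

/-- `K = ℚ(d_q, d)`, the field of fractions of `J̃`. -/
abbrev K : Type := FractionRing Jtilde

open Polynomial in
theorem eval_dickson_two_add_two {R : Type*} [CommRing R] (a x : R) (n : ℕ) :
    (dickson 2 a (n + 2)).eval x =
      x * (dickson 2 a (n + 1)).eval x - a * (dickson 2 a n).eval x := by
  simp [dickson_add_two]

open Polynomial in
theorem eval_dickson_two_neg_one_even_pos (b : ℤ) (m : ℕ) :
    0 < (dickson 2 (-1 : ℤ) (2 * m)).eval b ∧
      0 ≤ b * (dickson 2 (-1 : ℤ) (2 * m + 1)).eval b := by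
  induction m with
  | zero =>
    norm_num [dickson_zero, dickson_one]
    exact mul_self_nonneg b
  | succ m ih =>
    obtain ⟨h₁, h₂⟩ := ih
    have h₃ := eval_dickson_two_add_two (-1) b (2 * m)
    have h₄ := eval_dickson_two_add_two (-1) b (2 * m + 1)
    have h₅ : 0 < (dickson 2 (-1 : ℤ) (2 * m + 2)).eval b := by rw [h₃]; linarith
    refine ⟨h₅, ?_⟩
    rw [show 2 * (m + 1) + 1 = 2 * m + 1 + 2 by ring, h₄]
    nlinarith [mul_nonneg (mul_self_nonneg b) h₅.le]

/-- The specialization `d_q ↦ -1`, `d ↦ 1` of `J̃`. -/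
def specializeNegOne : Jtilde →ₐ[ℤ] ℤ :=
  AddMonoidAlgebra.lift ℤ ℤ (ℤ × ℤ)
    ((Units.coeHom ℤ).comp
      ((zpowersHom ℤˣ (-1)).comp (AddMonoidHom.toMultiplicative (AddMonoidHom.fst ℤ ℤ))))

theorem specializeNegOne_dq : specializeNegOne dq = -1 := by
  simp [specializeNegOne, dq]

open Polynomial in
theorem eval_dickson_two_dq_ne_zero (b : ℤ) {n : ℕ} (hn : Even n) :
    (dickson 2 (algebraMap Jtilde K dq) n).eval (b : K) ≠ 0 := by
  obtain ⟨m, rfl⟩ := hn.two_dvd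
  rw [← map_dickson, ← map_intCast (algebraMap Jtilde K), eval_map_apply]
  intro h
  rw [map_eq_zero_iff _ (IsFractionRing.injective Jtilde K)] at h
  have h' := congrArg specializeNegOne.toRingHom h
  rw [← eval_map_apply, map_dickson, map_intCast, map_zero] at h'
  change eval _ (dickson 2 (specializeNegOne dq) _) = 0 at h'
  rw [specializeNegOne_dq] at h'
  exact (eval_dickson_two_neg_one_even_pos b m).1.ne' h'

namespace MvPolynomial

/-- Substitution of the constant `c` for the first of two variables. -/
def substZero {R : Type*} [CommRing R] (c : R) :
    MvPolynomial (Fin 2) R →ₐ[R] MvPolynomial (Fin 2) R :=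
  aeval ![C c, X 1]

theorem X_zero_sub_C_dvd_sub_substZero {R : Type*} [CommRing R] (c : R)
    (p : MvPolynomial (Fin 2) R) : X 0 - C c ∣ p - substZero c p := by
  rw [← Ideal.mem_span_singleton, ← Ideal.Quotient.mk_eq_mk_iff_sub_mem]
  let π := Ideal.Quotient.mkₐ R (Ideal.span {(X 0 - C c : MvPolynomial (Fin 2) R)})
  suffices h : π = π.comp (substZero c) from DFunLike.congr_fun h p
  ext i
  fin_cases i
  · simp only [π, substZero, AlgHom.comp_apply, aeval_X]
    exact (Ideal.Quotient.mk_eq_mk_iff_sub_mem _ _).2 (Ideal.mem_span_singleton_self _)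
  · simp [substZero]

theorem mk_X_zero_sub_C_mem_nonZeroDivisors {R : Type*} [CommRing R] [IsDomain R] (c : R)
    {F : MvPolynomial (Fin 2) R} (hF : substZero c F ≠ 0) :
    Ideal.Quotient.mk (Ideal.span {F}) (X 0 - C c) ∈ nonZeroDivisors _ := by
  rw [mem_nonZeroDivisors_iff_right]
  intro y hy
  obtain ⟨y, rfl⟩ := Ideal.Quotient.mk_surjective y
  rw [← map_mul, Ideal.Quotient.eq_zero_iff_dvd] at hy
  obtain ⟨z, hz⟩ := hy
  have h₀ : substZero c (X 0 - C c) = 0 := by simp [substZero]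
  have hz₀ : substZero c z = 0 := by
    have h := congrArg (substZero c) hz
    rw [map_mul, map_mul, h₀, mul_zero] at h
    exact (mul_eq_zero.1 h.symm).resolve_left hF
  have hdvd := X_zero_sub_C_dvd_sub_substZero c z
  rw [hz₀, sub_zero] at hdvd
  obtain ⟨w, rfl⟩ := hdvd
  have hne : (X 0 - C c : MvPolynomial (Fin 2) R) ≠ 0 := by
    intro h
    have h := congrArg (eval ![c + 1, 0]) h
    simp at h
  rw [Ideal.Quotient.eq_zero_iff_dvd]
  exact ⟨w, mul_right_cancel₀ hne (by rw [hz]; ring)⟩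

open Polynomial in
theorem substZero_aeval_X_zero {R : Type*} [CommRing R] (c : R) (p : R[X]) :
    substZero c (Polynomial.aeval (X 0 : MvPolynomial (Fin 2) R) p) = C (p.eval c) := by
  rw [← Polynomial.aeval_algHom_apply]
  simp only [substZero, aeval_X, Matrix.cons_val_zero]
  exact Polynomial.aeval_algebraMap_apply_eq_algebraMap_eval c p

end MvPolynomial

/-- Lemma 4.4: in `A_K(0) = K[X₋₁, X₀]/(F)`, where
`F = E_{ℓ-1}(X₋₁; d_q)·(X₀ − D_ℓ(X₋₁; d_q))` (for odd `ℓ ≥ 3`), the image of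
`X₋₁ − b` is not a zero divisor, for every integer `b`.  Here `X₋₁ = MvPolynomial.X 0`
and `X₀ = MvPolynomial.X 1`, and `D_n(·; a)`, `E_n(·; a)` are the Dickson polynomials of
the first and second kind. -/
theorem X_neg_one_sub_int_not_zero_divisor (ℓ : ℕ) (hℓ : 3 ≤ ℓ) (hodd : Odd ℓ) (b : ℤ) :
    (Ideal.Quotient.mk (Ideal.span
        {Polynomial.aeval (MvPolynomial.X 0 : MvPolynomial (Fin 2) K)
            (Polynomial.dickson 2 (algebraMap Jtilde K dq) (ℓ - 1)) *
          (MvPolynomial.X 1 -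
            Polynomial.aeval (MvPolynomial.X 0 : MvPolynomial (Fin 2) K)
              (Polynomial.dickson 1 (algebraMap Jtilde K dq) ℓ))})
        (MvPolynomial.X 0 - (b : MvPolynomial (Fin 2) K))) ∈
      nonZeroDivisors _ := by
  have : IsDomain K := IsFractionRing.isDomain Jtilde
  rw [← map_intCast (MvPolynomial.C : K →+* MvPolynomial (Fin 2) K)]
  apply MvPolynomial.mk_X_zero_sub_C_mem_nonZeroDivisors
  rw [map_mul, map_sub, MvPolynomial.substZero_aeval_X_zero, MvPolynomial.substZero_aeval_X_zero]
  refine mul_ne_zero ?_ fun h => ?_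
  · rw [Ne, MvPolynomial.C_eq_zero]
    exact eval_dickson_two_dq_ne_zero b (Nat.Odd.sub_odd hodd odd_one)
  · have h₀ := congrArg (MvPolynomial.eval ![0, 0]) h
    have h₁ := congrArg (MvPolynomial.eval ![0, 1]) h
    simp [MvPolynomial.substZero] at h₀ h₁
    simp [h₀] at h₁
end
end

section
/- Let ℓ ≥ 3 be an odd integer, let K = ℚ(d_q, d) be the field of fractions of ℤ[d_q^{±1}, d^{±1}], and let A_K(0) = K[X_{-1}, X_0]/(F), where F = E_{ℓ-1}(X_{-1}; d_q)·(X_0 − D_ℓ(X_{-1}; d_q)). Then the images of X_0 − 2d and X_0 + 2d in A_K(0) are not zero divisors. (This is the concluding claim of the proof of Lemma 4.4.) -/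
noncomputable section

namespace Polynomial

theorem degree_dickson_le_and_degree_dickson_succ {R : Type*} [CommRing R] [IsDomain R]
    (k : ℕ) (a : R) (n : ℕ) :
    (dickson k a n).degree ≤ n ∧ (dickson k a (n + 1)).degree = (n + 1 : ℕ) := by
  induction n with
  | zero =>
    refine ⟨?_, by simp⟩
    have h : dickson k a 0 = C (3 - k : R) := by simp [map_ofNat C 3]
    rw [h]
    exact degree_C_le
  | succ n ih =>
    refine ⟨ih.2.le, ?_⟩
    have hX : (X * dickson k a (n + 1)).degree = ((n + 1 + 1 : ℕ) : WithBot ℕ) := by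
      rw [degree_mul, degree_X, ih.2, add_comm]
      rfl
    have hC : (C a * dickson k a n).degree < (X * dickson k a (n + 1)).degree := by
      rw [hX, C_mul']
      refine (degree_smul_le a _).trans_lt (ih.1.trans_lt ?_)
      exact_mod_cast (by omega : n < n + 1 + 1)
    rw [dickson_add_two, degree_sub_eq_left_of_degree_lt hC, hX]

theorem degree_dickson {R : Type*} [CommRing R] [IsDomain R] (k : ℕ) (a : R) {n : ℕ}
    (hn : n ≠ 0) : (dickson k a n).degree = n := by
  obtain ⟨m, rfl⟩ := Nat.exists_eq_succ_of_ne_zero hn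
  exact (degree_dickson_le_and_degree_dickson_succ k a m).2

end Polynomial

namespace MvPolynomial

theorem X_one_sub_C_dvd_of_aeval_eq_zero {R : Type*} [CommRing R] (c : R)
    {p : MvPolynomial (Fin 2) R}
    (hp : aeval ![(Polynomial.X : Polynomial R), Polynomial.C c] p = 0) :
    X 1 - C c ∣ p := by
  set I : Ideal (MvPolynomial (Fin 2) R) := Ideal.span {X 1 - C c}
  have h : ((Ideal.Quotient.mkₐ R I).comp (Polynomial.aeval (X 0))).comp
      (aeval ![(Polynomial.X : Polynomial R), Polynomial.C c]) = Ideal.Quotient.mkₐ R I := by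
    ext i
    fin_cases i
    · simp
    · simp only [AlgHom.comp_apply, aeval_X, Ideal.Quotient.mkₐ_eq_mk]
      refine (Ideal.Quotient.eq.2 ?_).symm
      simp [algebraMap_eq, I]
  have h' := DFunLike.congr_fun h p
  rw [AlgHom.comp_apply, hp, map_zero, eq_comm, Ideal.Quotient.mkₐ_eq_mk,
    Ideal.Quotient.eq_zero_iff_mem] at h'
  exact Ideal.mem_span_singleton.1 h'

/-- If `F` does not vanish on the line `X 1 = c`, then `X 1 - c` is not a zero divisor
modulo `F`. -/
theorem mk_X_one_sub_C_mem_nonZeroDivisors {R : Type*} [CommRing R] [IsDomain R] (c : R)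
    {F : MvPolynomial (Fin 2) R}
    (hF : aeval ![(Polynomial.X : Polynomial R), Polynomial.C c] F ≠ 0) :
    Ideal.Quotient.mk (Ideal.span {F}) (X 1 - C c) ∈ nonZeroDivisors _ := by
  have hne : (X 1 - C c : MvPolynomial (Fin 2) R) ≠ 0 := fun h => by
    have := congrArg (eval ![0, c + 1]) h
    simp at this
  rw [mem_nonZeroDivisors_iff_right]
  intro y hy
  obtain ⟨y, rfl⟩ := Ideal.Quotient.mk_surjective y
  rw [← map_mul, Ideal.Quotient.eq_zero_iff_dvd] at hy
  rw [Ideal.Quotient.eq_zero_iff_dvd]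
  obtain ⟨z, hz⟩ := hy
  have hz0 : aeval ![(Polynomial.X : Polynomial R), Polynomial.C c] z = 0 := by
    have := congrArg (aeval ![(Polynomial.X : Polynomial R), Polynomial.C c]) hz
    simpa [hF, Polynomial.algebraMap_eq] using this
  obtain ⟨w, rfl⟩ := X_one_sub_C_dvd_of_aeval_eq_zero c hz0
  refine ⟨w, mul_right_cancel₀ hne ?_⟩
  rw [hz]
  ring

theorem mk_X_one_sub_C_mem_nonZeroDivisors_of_dickson {R : Type*} [CommRing R] [IsDomain R]
    (a c : R) {m n : ℕ} (hm : m ≠ 0) (hn : n ≠ 0) :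
    Ideal.Quotient.mk (Ideal.span {Polynomial.aeval (X 0 : MvPolynomial (Fin 2) R)
        (Polynomial.dickson 2 a m) *
          (X 1 - Polynomial.aeval (X 0 : MvPolynomial (Fin 2) R) (Polynomial.dickson 1 a n))})
      (X 1 - C c) ∈ nonZeroDivisors _ := by
  apply mk_X_one_sub_C_mem_nonZeroDivisors
  have hE : Polynomial.dickson 2 a m ≠ 0 := fun h => by
    simpa [h] using Polynomial.degree_dickson 2 a hm
  have hD : Polynomial.C c - Polynomial.dickson 1 a n ≠ 0 := fun h => by
    have := Polynomial.degree_dickson 1 a hn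
    rw [← sub_eq_zero.1 h] at this
    have hle : (n : WithBot ℕ) ≤ 0 := this ▸ Polynomial.degree_C_le
    exact hn (by simpa using hle)
  simpa [← Polynomial.aeval_algHom_apply] using mul_ne_zero hE hD

end MvPolynomial

/-- The concluding claim of the proof of Lemma 4.4: in `A_K(0) = K[X₋₁, X₀]/(F)`,
where `F = E_{ℓ-1}(X₋₁; d_q)·(X₀ − D_ℓ(X₋₁; d_q))` (for odd `ℓ ≥ 3`), the images of
`X₀ − 2d` and `X₀ + 2d` are not zero divisors.  Here `X₋₁ = MvPolynomial.X 0` and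
`X₀ = MvPolynomial.X 1`, and `D_n(·; a)`, `E_n(·; a)` are the Dickson polynomials of the
first and second kind. -/
theorem X_zero_sub_two_d_not_zero_divisor (ℓ : ℕ) (hℓ : 3 ≤ ℓ) (hodd : Odd ℓ) :
    (Ideal.Quotient.mk (Ideal.span
        {Polynomial.aeval (MvPolynomial.X 0 : MvPolynomial (Fin 2) K)
            (Polynomial.dickson 2 (algebraMap Jtilde K dq) (ℓ - 1)) *
          (MvPolynomial.X 1 -
            Polynomial.aeval (MvPolynomial.X 0 : MvPolynomial (Fin 2) K)
              (Polynomial.dickson 1 (algebraMap Jtilde K dq) ℓ))})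
        (MvPolynomial.X 1 -
          2 * MvPolynomial.C (algebraMap Jtilde K dd))) ∈ nonZeroDivisors _ ∧
    (Ideal.Quotient.mk (Ideal.span
        {Polynomial.aeval (MvPolynomial.X 0 : MvPolynomial (Fin 2) K)
            (Polynomial.dickson 2 (algebraMap Jtilde K dq) (ℓ - 1)) *
          (MvPolynomial.X 1 -
            Polynomial.aeval (MvPolynomial.X 0 : MvPolynomial (Fin 2) K)
              (Polynomial.dickson 1 (algebraMap Jtilde K dq) ℓ))})
        (MvPolynomial.X 1 +
          2 * MvPolynomial.C (algebraMap Jtilde K dd))) ∈ nonZeroDivisors _ := by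
  have key (c : K) := MvPolynomial.mk_X_one_sub_C_mem_nonZeroDivisors_of_dickson
    (algebraMap Jtilde K dq) c (m := ℓ - 1) (n := ℓ) (by omega) (by omega)
  have h2 : (2 : MvPolynomial (Fin 2) K) = MvPolynomial.C 2 := (map_ofNat _ 2).symm
  constructor
  · rw [h2, ← map_mul]
    exact key _
  · rw [h2, ← map_mul, ← sub_neg_eq_add, ← map_neg]
    exact key _
end
end

section
/- Let K be a field of characteristic 0, let a ∈ K with a ≠ 0, and let ℓ ≥ 1. Then the polynomial E_{ℓ-1}(X; a)·(Y − D_ℓ(X; a)) is squarefree in the polynomial ring K[X, Y]. (This is the key intermediate claim in the proof of Theorem 4.3: the generator P_{ℓ-1}(X_{-1})·(X_0 − g(X_{-1})) of the defining ideal of A_ℂ(n) has no repeated irreducible factors.) -/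
namespace Polynomial

section CommRing

variable {R : Type*} [CommRing R] (a : R)

theorem dickson_two_sq_add_sq (n : ℕ) :
    dickson 2 a (n + 1) ^ 2 - X * dickson 2 a (n + 1) * dickson 2 a n + C a * dickson 2 a n ^ 2 =
      C a ^ (n + 1) := by
  induction n with
  | zero => simp; ring
  | succ n ih =>
    rw [dickson_add_two, pow_succ (C a), ← ih]
    ring

theorem X_sq_sub_mul_derivative_dickson_two (n : ℕ) :
    (X ^ 2 - 4 * C a) * derivative (dickson 2 a n) =
      ((n : R[X]) + 1) * (2 * dickson 2 a (n + 1) - X * dickson 2 a n) - X * dickson 2 a n := by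
  induction n using Nat.twoStepInduction with
  | zero => norm_num; ring
  | one => norm_num; ring
  | more n ih₀ ih₁ =>
    have h : derivative (dickson 2 a (n + 2)) = dickson 2 a (n + 1) +
        X * derivative (dickson 2 a (n + 1)) - C a * derivative (dickson 2 a n) := by
      simp
    rw [h, dickson_add_two 2 a (n + 1)]
    push_cast at ih₁ ⊢
    rw [dickson_add_two] at ih₁ ⊢
    linear_combination X * ih₁ - C a * ih₀

end CommRing

theorem separable_dickson_two {K : Type*} [Field K] [CharZero K] {a : K} (ha : a ≠ 0) (n : ℕ) :
    (dickson 2 a n).Separable := by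
  set p := dickson 2 a n
  set q := dickson 2 a (n + 1)
  have h₁ := dickson_two_sq_add_sq a n
  have h₂ := X_sq_sub_mul_derivative_dickson_two a n
  have hu : IsUnit (4 * ((n : K[X]) + 1) * C a ^ (n + 1) : K[X]) := by
    have : 4 * ((n : K[X]) + 1) * C a ^ (n + 1) = C (4 * (n + 1) * a ^ (n + 1)) := by simp [map_ofNat]
    rw [this, isUnit_C, isUnit_iff_ne_zero]
    exact mul_ne_zero (mul_ne_zero (by norm_num) n.cast_add_one_ne_zero) (pow_ne_zero _ ha)
  obtain ⟨v, hv⟩ := hu.exists_left_inv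
  refine ⟨v * (X * (2 * q - X * p) - ((n : K[X]) + 1) * (X ^ 2 - 4 * C a) * p),
    v * (X ^ 2 - 4 * C a) * (2 * q - X * p), ?_⟩
  linear_combination hv + v * (2 * q - X * p) * h₂ + 4 * ((n : K[X]) + 1) * v * h₁

theorem squarefree_C_mul_X_sub_C {R : Type*} [CommRing R] [IsDomain R]
    [UniqueFactorizationMonoid R] {p : R} (hp : Squarefree p) (q : R) :
    Squarefree (C p * (X - C q)) := by
  have hp₀ : p ≠ 0 := hp.ne_zero
  have eq_C_of_dvd {d : R[X]} (hd : d ∣ C p) : ∃ r, d = C r :=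
    ⟨_, eq_C_of_natDegree_eq_zero <| Nat.eq_zero_of_le_zero <|
      (natDegree_le_of_dvd hd (C_ne_zero.2 hp₀)).trans_eq (natDegree_C p)⟩
  refine squarefree_mul_iff.2 ⟨fun d hd hd' ↦ ?_, fun d hd ↦ ?_, (irreducible_X_sub_C q).squarefree⟩
  · obtain ⟨r, rfl⟩ := eq_C_of_dvd hd
    exact isUnit_C.2 ((monic_X_sub_C q).isPrimitive r hd')
  · obtain ⟨r, rfl⟩ := eq_C_of_dvd ((dvd_mul_right d d).trans hd)
    rw [← C_mul, C_dvd_iff_dvd_coeff] at hd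
    exact isUnit_C.2 (hp r (by simpa using hd 0))

end Polynomial

theorem MulEquiv.squarefree_map_iff {M N : Type*} [CommMonoid M] [CommMonoid N] (e : M ≃* N)
    {x : M} : Squarefree (e x) ↔ Squarefree x := by
  refine ⟨fun h d hd ↦ ?_, fun h d hd ↦ ?_⟩
  · exact (MulEquiv.isUnit_map e).1 (h (e d) (by simpa using map_dvd e hd))
  · exact (MulEquiv.isUnit_map e.symm).1 (h (e.symm d) (by simpa using map_dvd e.symm hd))

namespace MvPolynomial

/-- Bivariate polynomials as polynomials in `X 1` over the polynomials in `X 0`. -/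
noncomputable def finTwoAlgEquiv (R : Type*) [CommRing R] :
    MvPolynomial (Fin 2) R ≃ₐ[R] Polynomial (Polynomial R) :=
  ((renameEquiv R (Equiv.swap 0 1)).trans (finSuccEquiv R 1)).trans
    (Polynomial.mapAlgEquiv (uniqueAlgEquiv R (Fin 1)))

variable {R : Type*} [CommRing R]

theorem finTwoAlgEquiv_X_zero :
    finTwoAlgEquiv R (X 0) = Polynomial.C Polynomial.X := by
  have h : finSuccEquiv R 1 (X 1) = Polynomial.C (X 0) := finSuccEquiv_X_succ (j := 0)
  simp [finTwoAlgEquiv, h]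

theorem finTwoAlgEquiv_X_one : finTwoAlgEquiv R (X 1) = Polynomial.X := by
  simp [finTwoAlgEquiv, finSuccEquiv_X_zero]

theorem finTwoAlgEquiv_aeval_X_zero (p : Polynomial R) :
    finTwoAlgEquiv R (Polynomial.aeval (X 0) p) = Polynomial.C p := by
  rw [← AlgEquiv.coe_toAlgHom, ← Polynomial.aeval_algHom_apply, AlgEquiv.coe_toAlgHom,
    finTwoAlgEquiv_X_zero, ← Polynomial.CAlgHom_apply (R := R), Polynomial.aeval_algHom_apply,
    Polynomial.aeval_X_left_apply, Polynomial.CAlgHom_apply]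

end MvPolynomial

/-- The key intermediate claim in the proof of Theorem 4.3: over a field `K` of
characteristic `0`, for `a ≠ 0` and `ℓ ≥ 1`, the polynomial
`E_{ℓ-1}(X; a)·(Y − D_ℓ(X; a))` is squarefree in `K[X, Y]`.  Here `X = MvPolynomial.X 0`,
`Y = MvPolynomial.X 1`, and `D_n(·; a)`, `E_n(·; a)` are the Dickson polynomials of the
first and second kind. -/
theorem dickson_relation_squarefree (K : Type*) [Field K] [CharZero K]
    (a : K) (ha : a ≠ 0) (ℓ : ℕ) (hℓ : 1 ≤ ℓ) :
    Squarefree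
      (Polynomial.aeval (MvPolynomial.X 0 : MvPolynomial (Fin 2) K)
          (Polynomial.dickson 2 a (ℓ - 1)) *
        (MvPolynomial.X 1 -
          Polynomial.aeval (MvPolynomial.X 0 : MvPolynomial (Fin 2) K)
            (Polynomial.dickson 1 a ℓ))) := by
  refine (MvPolynomial.finTwoAlgEquiv K).toMulEquiv.squarefree_map_iff.1 ?_
  simpa [MvPolynomial.finTwoAlgEquiv_aeval_X_zero, MvPolynomial.finTwoAlgEquiv_X_one] using
    Polynomial.squarefree_C_mul_X_sub_C (Polynomial.separable_dickson_two ha (ℓ - 1)).squarefree _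
end

section
/- Let K be a field of characteristic 0 and let a ∈ K with a ≠ 0. Then for every n ≥ 0 the Dickson polynomial of the second kind E_n(X; a) ∈ K[X] is squarefree, i.e. it has no repeated roots in an algebraic closure of K. (This is the paper's claim, used in the proof of Theorem 4.3, that the polynomials Q_{p-1} have no repeated roots.) -/
namespace Polynomial

theorem dickson_two_succ_sq_sub_add_sq {R : Type*} [CommRing R] (a : R) (n : ℕ) :
    dickson 2 a (n + 1) ^ 2 - X * dickson 2 a (n + 1) * dickson 2 a n
      + C a * dickson 2 a n ^ 2 = C a ^ (n + 1) := by
  induction n with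
  | zero => simp only [dickson_zero, zero_add, dickson_one]; push_cast; ring
  | succ n ih =>
    rw [dickson_add_two]
    linear_combination C a * ih

theorem sq_sub_mul_derivative_dickson_two_succ {R : Type*} [CommRing R] (a : R) (n : ℕ) :
    (X ^ 2 - 4 * C a) * derivative (dickson 2 a (n + 1)) =
      ((n : R[X]) + 1) * X * dickson 2 a (n + 1) - 2 * C a * ((n : R[X]) + 2) * dickson 2 a n := by
  induction n using Nat.twoStepInduction with
  | zero =>
    simp only [dickson_zero, zero_add, dickson_one, derivative_X]
    push_cast
    ring
  | one =>
    simp only [dickson_add_two, dickson_zero, zero_add, dickson_one, derivative_sub,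
      derivative_mul, derivative_X, derivative_C, derivative_natCast, derivative_ofNat]
    push_cast
    ring
  | more n ih₀ ih₁ =>
    have h := dickson_add_two 2 a n
    rw [dickson_add_two 2 a (n + 1)]
    simp only [derivative_sub, derivative_mul, derivative_X, derivative_C]
    push_cast at ih₁ ⊢
    linear_combination X * ih₁ - C a * ih₀ + 2 * C a * ((n : R[X]) + 2) * h

end Polynomial

/-- The claim, used in the proof of Theorem 4.3, that the Dickson polynomials of the
second kind `E_n(X; a)` (the paper's `P_r` and `Q_r`) have no repeated roots: over a
field `K` of characteristic `0`, for `a ≠ 0`, the polynomial `E_n(X; a) ∈ K[X]` is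
squarefree for every `n ≥ 0`. -/
theorem dickson_two_squarefree (K : Type*) [Field K] [CharZero K]
    (a : K) (ha : a ≠ 0) (n : ℕ) :
    Squarefree (Polynomial.dickson 2 a n) := by
  exact (Polynomial.separable_dickson_two ha n).squarefree
end
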